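/- Let α be any constant with 0 < α < min{1, q}. There exists a constant C depending only on α, T, q, C₀ and on the initial data ρ₀,u₀,w₀,b₀,θ₀ — specifically on upper bounds for their H²((0,1))-norms, an upper bound for ∫₀¹ ρ₀(|ln ρ₀| + |ln θ₀|) dx, and a positive lower bound for ∫₀¹ ρ₀ dx — but not on the pointwise lower bounds of ρ₀ and θ₀, such that every smooth solution (ρ,u,w,b,θ) of the planar compressible MHD system on Q_T satisfies ∫₀^T (sup_{x∈[0,1]} θ(x,t))^{q−α+1} dt ≤ C. -/

import Mathlib

open Real MeasureTheory Set

noncomputable section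

/-- Partial derivative in the first (spatial) variable of `f : ℝ → ℝ → ℝ`, `f x t`. -/
def pdx (f : ℝ → ℝ → ℝ) : ℝ → ℝ → ℝ := fun x t => deriv (fun y => f y t) x

/-- Partial derivative in the second (time) variable. -/
def pdt (f : ℝ → ℝ → ℝ) : ℝ → ℝ → ℝ := fun x t => deriv (fun s => f x s) t

/-- The `L²(0,1)` norm of a function. -/
def L2norm (f : ℝ → ℝ) : ℝ := Real.sqrt (∫ x in (0:ℝ)..1, (f x) ^ 2)

/-- The `H²(0,1)` norm of a (smooth) function. -/
def H2norm (f : ℝ → ℝ) : ℝ :=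
  Real.sqrt (∫ x in (0:ℝ)..1, (f x) ^ 2 + (deriv f x) ^ 2 + (deriv (deriv f) x) ^ 2)

/-- A smooth solution of the planar compressible MHD system (all physical constants
normalized to `1`, perfect-gas pressure `P = ρθ`, heat conductivity `κ`) on
`Q_T = [0,1] × [0,T]`:  `ρ, u, θ` are scalar fields, `w, b` are `ℝ²`-valued fields
(given by their two components), everything is smooth, `ρ > 0` and `θ > 0` on `Q_T`,
the five PDEs hold on `Q_T`, and the boundary conditions
`u = 0`, `w = 0`, `b = 0`, `θ_x = 0` hold at `x = 0` and `x = 1`. -/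
structure MHDSol (T : ℝ) (κ : ℝ → ℝ) where
  ρ : ℝ → ℝ → ℝ
  u : ℝ → ℝ → ℝ
  θ : ℝ → ℝ → ℝ
  w : Fin 2 → ℝ → ℝ → ℝ
  b : Fin 2 → ℝ → ℝ → ℝ
  smooth_ρ : ContDiff ℝ (⊤ : ℕ∞) (Function.uncurry ρ)
  smooth_u : ContDiff ℝ (⊤ : ℕ∞) (Function.uncurry u)
  smooth_θ : ContDiff ℝ (⊤ : ℕ∞) (Function.uncurry θ)
  smooth_w : ∀ i, ContDiff ℝ (⊤ : ℕ∞) (Function.uncurry (w i))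
  smooth_b : ∀ i, ContDiff ℝ (⊤ : ℕ∞) (Function.uncurry (b i))
  ρ_pos : ∀ x ∈ Set.Icc (0:ℝ) 1, ∀ t ∈ Set.Icc (0:ℝ) T, 0 < ρ x t
  θ_pos : ∀ x ∈ Set.Icc (0:ℝ) 1, ∀ t ∈ Set.Icc (0:ℝ) T, 0 < θ x t
  eq_mass : ∀ x ∈ Set.Icc (0:ℝ) 1, ∀ t ∈ Set.Icc (0:ℝ) T,
    pdt ρ x t + pdx (fun x t => ρ x t * u x t) x t = 0
  eq_mom : ∀ x ∈ Set.Icc (0:ℝ) 1, ∀ t ∈ Set.Icc (0:ℝ) T,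
    pdt (fun x t => ρ x t * u x t) x t
      + pdx (fun x t =>
          ρ x t * (u x t) ^ 2 + ρ x t * θ x t + (∑ i, (b i x t) ^ 2) / 2) x t
      = pdx (pdx u) x t
  eq_w : ∀ i, ∀ x ∈ Set.Icc (0:ℝ) 1, ∀ t ∈ Set.Icc (0:ℝ) T,
    pdt (fun x t => ρ x t * w i x t) x t
      + pdx (fun x t => ρ x t * u x t * w i x t - b i x t) x t
      = pdx (pdx (w i)) x t
  eq_b : ∀ i, ∀ x ∈ Set.Icc (0:ℝ) 1, ∀ t ∈ Set.Icc (0:ℝ) T,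
    pdt (b i) x t + pdx (fun x t => u x t * b i x t - w i x t) x t
      = pdx (pdx (b i)) x t
  eq_θ : ∀ x ∈ Set.Icc (0:ℝ) 1, ∀ t ∈ Set.Icc (0:ℝ) T,
    pdt (fun x t => ρ x t * θ x t) x t
      + pdx (fun x t => ρ x t * u x t * θ x t) x t
      - pdx (fun x t => κ (θ x t) * pdx θ x t) x t
      = (pdx u x t) ^ 2 + (∑ i, (pdx (w i) x t) ^ 2) + (∑ i, (pdx (b i) x t) ^ 2)
        - ρ x t * θ x t * pdx u x t
  bc_u : ∀ t ∈ Set.Icc (0:ℝ) T, u 0 t = 0 ∧ u 1 t = 0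
  bc_w : ∀ i, ∀ t ∈ Set.Icc (0:ℝ) T, w i 0 t = 0 ∧ w i 1 t = 0
  bc_b : ∀ i, ∀ t ∈ Set.Icc (0:ℝ) T, b i 0 t = 0 ∧ b i 1 t = 0
  bc_θ : ∀ t ∈ Set.Icc (0:ℝ) T, pdx θ 0 t = 0 ∧ pdx θ 1 t = 0

/-- The heat conductivity `κ` is `C²` on `[0,∞)` and satisfies
`C₀⁻¹ (1 + s^q) ≤ κ(s) ≤ C₀ (1 + s^q)` there. -/
def KappaHyp (q C₀ : ℝ) (κ : ℝ → ℝ) : Prop :=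
  ContDiffOn ℝ 2 κ (Set.Ici 0) ∧
  (∀ s : ℝ, 0 ≤ s → C₀⁻¹ * (1 + s ^ q) ≤ κ s) ∧
  (∀ s : ℝ, 0 ≤ s → κ s ≤ C₀ * (1 + s ^ q))

/-- Bounds on the initial data: `A` is an upper bound for the `H²(0,1)` norms of
`ρ₀, u₀, w₀, b₀, θ₀`, `B` is an upper bound for `∫₀¹ ρ₀ (|ln ρ₀| + |ln θ₀|) dx`, and
`M` is a (positive) lower bound for the total mass `∫₀¹ ρ₀ dx`. -/
def InitBounds {T : ℝ} {κ : ℝ → ℝ} (sol : MHDSol T κ) (A B M : ℝ) : Prop :=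
  H2norm (fun x => sol.ρ x 0) ≤ A ∧ H2norm (fun x => sol.u x 0) ≤ A ∧
  H2norm (fun x => sol.θ x 0) ≤ A ∧
  (∀ i, H2norm (fun x => sol.w i x 0) ≤ A) ∧
  (∀ i, H2norm (fun x => sol.b i x 0) ≤ A) ∧
  (∫ x in (0:ℝ)..1, sol.ρ x 0 * (|Real.log (sol.ρ x 0)| + |Real.log (sol.θ x 0)|)) ≤ B ∧
  M ≤ ∫ x in (0:ℝ)..1, sol.ρ x 0

/-- `G` is an upper bound for the `L²(0,1)` norms of the compatibility functions
`g₁ = (∂ₓ²u₀ − ∂ₓ(ρ₀θ₀ + |b₀|²/2))/√ρ₀`, `g₂ = (∂ₓ²w₀ − ∂ₓb₀)/√ρ₀`,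
`g₃ = (∂ₓ(κ(θ₀)∂ₓθ₀) + (∂ₓu₀)² + |∂ₓw₀|² + |∂ₓb₀|²)/√ρ₀`. -/
def CompatBounds {T : ℝ} {κ : ℝ → ℝ} (sol : MHDSol T κ) (G : ℝ) : Prop :=
  L2norm (fun x =>
      (pdx (pdx sol.u) x 0
        - pdx (fun x t => sol.ρ x t * sol.θ x t + (∑ i, (sol.b i x t) ^ 2) / 2) x 0)
      / Real.sqrt (sol.ρ x 0)) ≤ G ∧
  (∀ i, L2norm (fun x =>
      (pdx (pdx (sol.w i)) x 0 - pdx (sol.b i) x 0) / Real.sqrt (sol.ρ x 0)) ≤ G) ∧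
  L2norm (fun x =>
      (pdx (fun x t => κ (sol.θ x t) * pdx sol.θ x t) x 0
        + (pdx sol.u x 0) ^ 2 + (∑ i, (pdx (sol.w i) x 0) ^ 2)
        + (∑ i, (pdx (sol.b i) x 0) ^ 2))
      / Real.sqrt (sol.ρ x 0)) ≤ G

lemma pdx_eq {f : ℝ → ℝ → ℝ} (hf : ContDiff ℝ (⊤ : ℕ∞) (Function.uncurry f)) (x t : ℝ) :
    HasDerivAt (fun y => f y t) (fderiv ℝ (Function.uncurry f) (x, t) (1, 0)) x := by
  have h1 : HasFDerivAt (Function.uncurry f) (fderiv ℝ (Function.uncurry f) (x, t)) (x, t) :=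
    (hf.differentiable (by simp)).differentiableAt.hasFDerivAt
  have h2 : HasDerivAt (fun y : ℝ => (y, t)) ((1 : ℝ), (0 : ℝ)) x :=
    (hasDerivAt_id x).prodMk (hasDerivAt_const x t)
  exact h1.comp_hasDerivAt x h2

lemma pdt_eq {f : ℝ → ℝ → ℝ} (hf : ContDiff ℝ (⊤ : ℕ∞) (Function.uncurry f)) (x t : ℝ) :
    HasDerivAt (fun s => f x s) (fderiv ℝ (Function.uncurry f) (x, t) (0, 1)) t := by
  have h1 : HasFDerivAt (Function.uncurry f) (fderiv ℝ (Function.uncurry f) (x, t)) (x, t) :=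
    (hf.differentiable (by simp)).differentiableAt.hasFDerivAt
  have h2 : HasDerivAt (fun y : ℝ => (x, y)) ((0 : ℝ), (1 : ℝ)) t :=
    (hasDerivAt_const t x).prodMk (hasDerivAt_id t)
  exact h1.comp_hasDerivAt t h2

lemma hd_x {f : ℝ → ℝ → ℝ} (hf : ContDiff ℝ (⊤ : ℕ∞) (Function.uncurry f)) (x t : ℝ) :
    HasDerivAt (fun y => f y t) (pdx f x t) x :=
  (pdx_eq hf x t).differentiableAt.hasDerivAt

lemma hd_t {f : ℝ → ℝ → ℝ} (hf : ContDiff ℝ (⊤ : ℕ∞) (Function.uncurry f)) (x t : ℝ) :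
    HasDerivAt (fun s => f x s) (pdt f x t) t :=
  (pdt_eq hf x t).differentiableAt.hasDerivAt

lemma sm_pdx {f : ℝ → ℝ → ℝ} (hf : ContDiff ℝ (⊤ : ℕ∞) (Function.uncurry f)) :
    ContDiff ℝ (⊤ : ℕ∞) (Function.uncurry (pdx f)) := by
  have : Function.uncurry (pdx f) = fun p => fderiv ℝ (Function.uncurry f) p (1, 0) := by
    ext ⟨x, t⟩
    exact (pdx_eq hf x t).deriv
  rw [this]
  exact (hf.fderiv_right (m := (⊤ : ℕ∞)) (by simp)).clm_apply contDiff_const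

lemma sm_pdt {f : ℝ → ℝ → ℝ} (hf : ContDiff ℝ (⊤ : ℕ∞) (Function.uncurry f)) :
    ContDiff ℝ (⊤ : ℕ∞) (Function.uncurry (pdt f)) := by
  have : Function.uncurry (pdt f) = fun p => fderiv ℝ (Function.uncurry f) p (0, 1) := by
    ext ⟨x, t⟩
    exact (pdt_eq hf x t).deriv
  rw [this]
  exact (hf.fderiv_right (m := (⊤ : ℕ∞)) (by simp)).clm_apply contDiff_const

lemma clamp_ext {a T : ℝ} (ha : 0 ≤ a) (hT : 0 ≤ T) {h : ℝ → ℝ → ℝ}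
    (hc : ContinuousOn (Function.uncurry h) (Icc 0 a ×ˢ Icc 0 T)) :
    ∃ hca : ℝ → ℝ → ℝ, Continuous (Function.uncurry hca) ∧
      ∀ x ∈ Icc (0:ℝ) a, ∀ t ∈ Icc (0:ℝ) T, hca x t = h x t := by
  refine ⟨fun x t => h (projIcc 0 a ha x) (projIcc 0 T hT t), ?_, ?_⟩
  · have := hc.comp_continuous
      (f := fun p : ℝ × ℝ => (((projIcc 0 a ha p.1 : ℝ)), ((projIcc 0 T hT p.2 : ℝ))))
      (by fun_prop) (fun p => ⟨(projIcc 0 a ha p.1).2, (projIcc 0 T hT p.2).2⟩)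
    exact this
  · intro x hx t ht
    simp only [projIcc_of_mem ha hx, projIcc_of_mem hT ht]

lemma fubini_cont {a T : ℝ} (h : ℝ → ℝ → ℝ) (hc : Continuous (Function.uncurry h)) :
    ∫ t in (0:ℝ)..T, ∫ x in (0:ℝ)..a, h x t = ∫ x in (0:ℝ)..a, ∫ t in (0:ℝ)..T, h x t := by
  rw [intervalIntegral_intervalIntegral_swap]
  have h1 : Continuous (Function.uncurry fun t x => h x t) := hc.comp continuous_swap
  exact (h1.continuousOn.integrableOn_compact (isCompact_uIcc.prod isCompact_uIcc)).mono_set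
    (prod_mono uIoc_subset_uIcc uIoc_subset_uIcc)

lemma cons_law {a T : ℝ} (ha : 0 ≤ a) (hT : 0 ≤ T) (f g ft gx : ℝ → ℝ → ℝ)
    (hf : ∀ x ∈ Icc (0:ℝ) a, ∀ t ∈ Icc (0:ℝ) T, HasDerivAt (fun s => f x s) (ft x t) t)
    (hg : ∀ x ∈ Icc (0:ℝ) a, ∀ t ∈ Icc (0:ℝ) T, HasDerivAt (fun y => g y t) (gx x t) x)
    (cf : ContinuousOn (Function.uncurry ft) (Icc 0 a ×ˢ Icc 0 T))
    (cg : ContinuousOn (Function.uncurry gx) (Icc 0 a ×ˢ Icc 0 T)) :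
    IntervalIntegrable (fun t => ∫ x in (0:ℝ)..a, (ft x t + gx x t)) volume 0 T ∧
    ∫ t in (0:ℝ)..T, ∫ x in (0:ℝ)..a, (ft x t + gx x t)
      = (∫ x in (0:ℝ)..a, (f x T - f x 0)) + ∫ t in (0:ℝ)..T, (g a t - g 0 t) := by
  obtain ⟨F, cF, eF⟩ := clamp_ext ha hT cf
  obtain ⟨G, cG, eG⟩ := clamp_ext ha hT cg
  have cF' : Continuous (Function.uncurry fun t x => F x t) := cF.comp continuous_swap
  have cG' : Continuous (Function.uncurry fun t x => G x t) := cG.comp continuous_swap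
  have ua : uIcc 0 a = Icc 0 a := uIcc_of_le ha
  have uT : uIcc 0 T = Icc 0 T := uIcc_of_le hT
  have iF : ∀ t, IntervalIntegrable (fun x => F x t) volume 0 a := fun t =>
    (cF.comp (continuous_id.prodMk continuous_const)).intervalIntegrable _ _
  have iG : ∀ t, IntervalIntegrable (fun x => G x t) volume 0 a := fun t =>
    (cG.comp (continuous_id.prodMk continuous_const)).intervalIntegrable _ _
  have kF : Continuous fun t => ∫ x in (0:ℝ)..a, F x t :=
    intervalIntegral.continuous_parametric_intervalIntegral_of_continuous' cF' 0 a
  have kG : Continuous fun t => ∫ x in (0:ℝ)..a, G x t :=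
    intervalIntegral.continuous_parametric_intervalIntegral_of_continuous' cG' 0 a
  have e1 : ∀ t ∈ uIcc 0 T, ∫ x in (0:ℝ)..a, (ft x t + gx x t)
      = (∫ x in (0:ℝ)..a, F x t) + ∫ x in (0:ℝ)..a, G x t := by
    intro t ht
    rw [uT] at ht
    rw [← intervalIntegral.integral_add (iF t) (iG t)]
    apply intervalIntegral.integral_congr
    intro x hx
    rw [ua] at hx
    simp only [eF x hx t ht, eG x hx t ht]
  constructor
  · refine ((kF.add kG).intervalIntegrable 0 T).congr ?_
    intro t ht
    exact (e1 t (uIoc_subset_uIcc ht)).symm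
  · rw [intervalIntegral.integral_congr e1, intervalIntegral.integral_add
      (kF.intervalIntegrable _ _) (kG.intervalIntegrable _ _), fubini_cont F cF]
    congr 1
    · apply intervalIntegral.integral_congr
      intro x hx
      rw [ua] at hx
      simp only
      rw [intervalIntegral.integral_eq_sub_of_hasDerivAt (f := fun s => f x s)]
      · intro t ht
        rw [uT] at ht
        rw [eF x hx t ht]
        exact hf x hx t ht
      · exact (cF.comp (continuous_const.prodMk continuous_id)).intervalIntegrable _ _
    · apply intervalIntegral.integral_congr
      intro t ht
      rw [uT] at ht
      simp only
      rw [intervalIntegral.integral_eq_sub_of_hasDerivAt (f := fun s => g s t)]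
      · intro x hx
        rw [ua] at hx
        rw [eG x hx t ht]
        exact hg x hx t ht
      · exact iG t

/-- Sobolev-type pointwise bound. -/
lemma sob {f : ℝ → ℝ} (hf : ContDiff ℝ (⊤ : ℕ∞) f) {A : ℝ} (hA : H2norm f ≤ A)
    {x : ℝ} (hx : x ∈ Icc (0:ℝ) 1) : |f x| ≤ 1 + A ^ 2 := by
  have c0 : Continuous f := hf.continuous
  have c1 : Continuous (deriv f) := hf.continuous_deriv (by simp)
  have hf1 : ContDiff ℝ (⊤ : ℕ∞) (deriv f) := by
    have := (contDiff_infty_iff_deriv (𝕜 := ℝ) (f := f)).1 hf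
    exact this.2
  have c2 : Continuous (deriv (deriv f)) := hf1.continuous_deriv (by simp)
  have hI : (∫ x in (0:ℝ)..1, (f x) ^ 2 + (deriv f x) ^ 2 + (deriv (deriv f) x) ^ 2) ≤ A ^ 2 := by
    have h0 : 0 ≤ ∫ x in (0:ℝ)..1, (f x) ^ 2 + (deriv f x) ^ 2 + (deriv (deriv f) x) ^ 2 :=
      intervalIntegral.integral_nonneg (by norm_num) (fun x _ => by positivity)
    have h1 := Real.sq_sqrt h0
    rw [← h1]
    exact pow_le_pow_left₀ (Real.sqrt_nonneg _) hA 2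
  have key : ∀ y ∈ Icc (0:ℝ) 1, |f x| ≤ |f y| + ∫ z in (0:ℝ)..1, |deriv f z| := by
    intro y hy
    have e : ∫ z in y..x, deriv f z = f x - f y :=
      intervalIntegral.integral_deriv_eq_sub
        (fun z _ => (hf.differentiable (by simp)).differentiableAt)
        (c1.intervalIntegrable _ _)
    have e2 : |f x - f y| ≤ ∫ z in (0:ℝ)..1, |deriv f z| := by
      rw [← e, ← Real.norm_eq_abs]
      refine (intervalIntegral.norm_integral_le_integral_norm_uIoc).trans ?_
      rw [intervalIntegral.integral_of_le (by norm_num : (0:ℝ) ≤ 1)]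
      simp only [Real.norm_eq_abs]
      apply setIntegral_mono_set
      · exact (c1.abs.intervalIntegrable 0 1).1
      · exact Filter.Eventually.of_forall (fun _ => abs_nonneg _)
      · apply LE.le.eventuallyLE
        intro z hz
        rcases le_total y x with h | h
        · rw [uIoc_of_le h] at hz
          exact ⟨lt_of_le_of_lt hy.1 hz.1, hz.2.trans hx.2⟩
        · rw [uIoc_of_ge h] at hz
          exact ⟨lt_of_le_of_lt hx.1 hz.1, hz.2.trans hy.2⟩
    have := abs_sub_abs_le_abs_sub (f x) (f y)
    linarith
  have k2 : ∫ y in (0:ℝ)..1, |f x| ≤ ∫ y in (0:ℝ)..1, (|f y| + ∫ z in (0:ℝ)..1, |deriv f z|) :=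
    intervalIntegral.integral_mono_on (by norm_num) (by simp)
      ((c0.abs.add continuous_const).intervalIntegrable _ _) key
  rw [intervalIntegral.integral_add (c0.abs.intervalIntegrable _ _) (by simp)] at k2
  simp only [intervalIntegral.integral_const, sub_zero, one_smul] at k2
  rw [← intervalIntegral.integral_add (c0.abs.intervalIntegrable _ _)
    (c1.abs.intervalIntegrable _ _)] at k2
  refine k2.trans ?_
  calc ∫ y in (0:ℝ)..1, (|f y| + |deriv f y|)
      ≤ ∫ y in (0:ℝ)..1, (1 + ((f y) ^ 2 + (deriv f y) ^ 2 + (deriv (deriv f) y) ^ 2)) := by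
        apply intervalIntegral.integral_mono_on (by norm_num)
        · exact (c0.abs.add c1.abs).intervalIntegrable _ _
        · exact (by fun_prop : Continuous _).intervalIntegrable _ _
        · intro y _
          nlinarith [sq_nonneg (|f y| - 1), sq_nonneg (|deriv f y| - 1), sq_abs (f y),
            sq_abs (deriv f y), sq_nonneg (deriv (deriv f) y), sq_nonneg (f y),
            sq_nonneg (deriv f y)]
    _ = 1 + ∫ y in (0:ℝ)..1, ((f y) ^ 2 + (deriv f y) ^ 2 + (deriv (deriv f) y) ^ 2) := by
        rw [intervalIntegral.integral_add (by simp)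
          ((by fun_prop : Continuous _).intervalIntegrable _ _)]
        simp
    _ ≤ 1 + A ^ 2 := by linarith

lemma cs01 {h : ℝ → ℝ} (hc : ContinuousOn h (Icc 0 1)) :
    (∫ x in (0:ℝ)..1, |h x|) ^ 2 ≤ ∫ x in (0:ℝ)..1, (h x) ^ 2 := by
  set c := ∫ x in (0:ℝ)..1, |h x| with hcdef
  have u : uIcc (0:ℝ) 1 = Icc 0 1 := uIcc_of_le (by norm_num)
  have i1 : IntervalIntegrable (fun x => |h x|) volume 0 1 :=
    ContinuousOn.intervalIntegrable (by rw [u]; exact hc.abs)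
  have i2 : IntervalIntegrable (fun x => (h x) ^ 2) volume 0 1 :=
    ContinuousOn.intervalIntegrable (by rw [u]; exact hc.pow 2)
  have h0 : ∫ x in (0:ℝ)..1, (2 * c * |h x| - c ^ 2) ≤ ∫ x in (0:ℝ)..1, (h x) ^ 2 := by
    apply intervalIntegral.integral_mono_on (by norm_num) _ i2
    · intro x _
      nlinarith [sq_nonneg (|h x| - c), sq_abs (h x)]
    · exact (i1.const_mul _).sub (by simp)
  rw [intervalIntegral.integral_sub (i1.const_mul _) (by simp),
    intervalIntegral.integral_const_mul, ← hcdef] at h0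
  simp at h0
  nlinarith

/-- Young-type absorption. -/
lemma young_abs {r q δ : ℝ} (hr : 0 ≤ r) (hq : 0 < q) (hδ : 0 < δ) :
    ∃ C : ℝ, 0 ≤ C ∧ ∀ y : ℝ, 0 < y → y ^ r ≤ δ * y ^ (r + q) + C := by
  refine ⟨(δ⁻¹ ^ (1 / q)) ^ r, by positivity, fun y hy => ?_⟩
  rcases le_total y (δ⁻¹ ^ (1 / q)) with h | h
  · have := Real.rpow_le_rpow hy.le h hr
    have : 0 ≤ δ * y ^ (r + q) := by positivity
    linarith
  · have h1 : δ⁻¹ ≤ y ^ q := by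
      have := Real.rpow_le_rpow (by positivity) h hq.le
      rwa [← Real.rpow_mul (by positivity), one_div, inv_mul_cancel₀ hq.ne', Real.rpow_one] at this
    have h2 : 1 ≤ δ * y ^ q := by
      calc (1:ℝ) = δ * δ⁻¹ := by field_simp
        _ ≤ _ := by gcongr
    rw [Real.rpow_add hy]
    have h3 : 0 ≤ (δ⁻¹ ^ (1 / q)) ^ r := by positivity
    have h4 : 0 < y ^ r := by positivity
    nlinarith

/-- Maximum principle for a transport inequality. -/
lemma max_princ {T : ℝ} (hT : 0 ≤ T) (F u Ft Fx : ℝ → ℝ → ℝ)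
    (hc : ContinuousOn (Function.uncurry F) (Icc 0 1 ×ˢ Icc 0 T))
    (hFt : ∀ x ∈ Icc (0:ℝ) 1, ∀ t ∈ Icc (0:ℝ) T, HasDerivAt (fun s => F x s) (Ft x t) t)
    (hFx : ∀ x ∈ Ioo (0:ℝ) 1, ∀ t ∈ Icc (0:ℝ) T, HasDerivAt (fun y => F y t) (Fx x t) x)
    (hu : ∀ t ∈ Icc (0:ℝ) T, u 0 t = 0 ∧ u 1 t = 0)
    (hle : ∀ x ∈ Icc (0:ℝ) 1, ∀ t ∈ Icc (0:ℝ) T, Ft x t + u x t * Fx x t ≤ 0)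
    {K : ℝ} (h0 : ∀ x ∈ Icc (0:ℝ) 1, F x 0 ≤ K) :
    ∀ x ∈ Icc (0:ℝ) 1, ∀ t ∈ Icc (0:ℝ) T, F x t ≤ K := by
  intro x hx t ht
  have key : ∀ ε > 0, F x t - ε * t ≤ K := by
    intro ε hε
    have hc' : ContinuousOn (fun p : ℝ × ℝ => Function.uncurry F p - ε * p.2)
        (Icc 0 1 ×ˢ Icc 0 T) := hc.sub (by fun_prop)
    obtain ⟨⟨x1, t1⟩, ⟨hx1, ht1⟩, hm⟩ := (isCompact_Icc.prod isCompact_Icc).exists_isMaxOn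
      ⟨(x, t), ⟨hx, ht⟩⟩ hc'
    simp only at hx1 ht1
    have hm' : ∀ y ∈ Icc (0:ℝ) 1, ∀ s ∈ Icc (0:ℝ) T, F y s - ε * s ≤ F x1 t1 - ε * t1 :=
      fun y hy s hs => hm (a := (y, s)) ⟨hy, hs⟩
    have hle1 := hm' x hx t ht
    rcases ht1.1.eq_or_lt with h | h
    · rw [← h] at hle1
      have := h0 x1 hx1
      simp at hle1
      linarith
    · exfalso
      -- time derivative
      have d1 : HasDerivAt (fun s => F x1 s - ε * s) (Ft x1 t1 - ε * 1) t1 :=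
        (hFt x1 hx1 t1 ht1).sub ((hasDerivAt_id t1).const_mul ε)
      have g1 : 0 ≤ Ft x1 t1 - ε * 1 := by
        by_contra hneg
        push Not at hneg
        have hs := (hasDerivWithinAt_iff_tendsto_slope' (by simp)).1 (d1.hasDerivWithinAt (s := Iio t1))
        have ev := hs.eventually (gt_mem_nhds hneg)
        have ev2 : ∀ᶠ s in nhdsWithin t1 (Iio t1), s ∈ Ioo 0 t1 := Ioo_mem_nhdsLT h
        obtain ⟨s, hs1, hs2⟩ := (ev.and ev2).exists
        rw [slope_def_field] at hs1
        have a1 := hm' x1 hx1 s ⟨hs2.1.le, hs2.2.le.trans ht1.2⟩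
        have : 0 ≤ ((F x1 s - ε * s) - (F x1 t1 - ε * t1)) / (s - t1) :=
          div_nonneg_of_nonpos (by linarith) (by linarith [hs2.2])
        linarith
      have g2 : u x1 t1 * Fx x1 t1 = 0 := by
        rcases hx1.1.eq_or_lt with hca | hca
        · rw [← hca, (hu t1 ht1).1, zero_mul]
        rcases hx1.2.eq_or_lt with hcc | hcc
        · rw [hcc, (hu t1 ht1).2, zero_mul]
        have : IsLocalMax (fun y => F y t1) x1 := by
          filter_upwards [Icc_mem_nhds hca hcc] with y hy
          linarith [hm' y hy t1 ht1]
        rw [this.hasDerivAt_eq_zero (hFx x1 ⟨hca, hcc⟩ t1 ht1), mul_zero]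
      linarith [hle x1 hx1 t1 ht1]
  refine le_of_forall_pos_le_add (fun ε hε => ?_)
  have := key (ε / (T + 1)) (by positivity)
  have h2 : ε / (T + 1) * t ≤ ε := by
    rw [div_mul_eq_mul_div, div_le_iff₀ (by linarith)]
    nlinarith [ht.1, ht.2]
  linarith

section expand
variable {T : ℝ} {κ : ℝ → ℝ} (sol : MHDSol T κ)

lemma mass' {x t : ℝ} (hx : x ∈ Icc (0:ℝ) 1) (ht : t ∈ Icc (0:ℝ) T) :
    pdt sol.ρ x t + (pdx sol.ρ x t * sol.u x t + sol.ρ x t * pdx sol.u x t) = 0 := by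
  have h := sol.eq_mass x hx t ht
  have e : pdx (fun x t => sol.ρ x t * sol.u x t) x t
      = pdx sol.ρ x t * sol.u x t + sol.ρ x t * pdx sol.u x t :=
    ((hd_x sol.smooth_ρ x t).mul (hd_x sol.smooth_u x t)).deriv
  rw [e] at h
  exact h

lemma mom_x (x t : ℝ) : HasDerivAt (fun x => sol.ρ x t * (sol.u x t) ^ 2 + sol.ρ x t * sol.θ x t
      + (∑ i, (sol.b i x t) ^ 2) / 2)
      (pdx sol.ρ x t * (sol.u x t) ^ 2 + sol.ρ x t * (2 * sol.u x t * pdx sol.u x t)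
      + (pdx sol.ρ x t * sol.θ x t + sol.ρ x t * pdx sol.θ x t)
      + (sol.b 0 x t * pdx (sol.b 0) x t + sol.b 1 x t * pdx (sol.b 1) x t)) x := by
  have hρ := hd_x sol.smooth_ρ x t
  have hu := hd_x sol.smooth_u x t
  have hθ := hd_x sol.smooth_θ x t
  have hb := fun i => hd_x (sol.smooth_b i) x t
  simp only [Fin.sum_univ_two, pow_two]
  exact (((hρ.mul (hu.mul hu)).add (hρ.mul hθ)).add
    ((((hb 0).mul (hb 0)).add ((hb 1).mul (hb 1))).div_const 2)).congr_deriv (by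
      simp only [Pi.mul_apply]; ring)

lemma mom' {x t : ℝ} (hx : x ∈ Icc (0:ℝ) 1) (ht : t ∈ Icc (0:ℝ) T) :
    (pdt sol.ρ x t * sol.u x t + sol.ρ x t * pdt sol.u x t) +
      (pdx sol.ρ x t * (sol.u x t) ^ 2 + sol.ρ x t * (2 * sol.u x t * pdx sol.u x t)
      + (pdx sol.ρ x t * sol.θ x t + sol.ρ x t * pdx sol.θ x t)
      + (sol.b 0 x t * pdx (sol.b 0) x t + sol.b 1 x t * pdx (sol.b 1) x t))
      = pdx (pdx sol.u) x t := by
  have h := sol.eq_mom x hx t ht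
  have e1 : pdt (fun x t => sol.ρ x t * sol.u x t) x t
      = pdt sol.ρ x t * sol.u x t + sol.ρ x t * pdt sol.u x t :=
    ((hd_t sol.smooth_ρ x t).mul (hd_t sol.smooth_u x t)).deriv
  rw [e1] at h
  rw [← h]
  congr 1
  exact (mom_x sol x t).deriv.symm

lemma w' (i : Fin 2) {x t : ℝ} (hx : x ∈ Icc (0:ℝ) 1) (ht : t ∈ Icc (0:ℝ) T) :
    (pdt sol.ρ x t * sol.w i x t + sol.ρ x t * pdt (sol.w i) x t) +
      ((pdx sol.ρ x t * sol.u x t + sol.ρ x t * pdx sol.u x t) * sol.w i x t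
        + sol.ρ x t * sol.u x t * pdx (sol.w i) x t - pdx (sol.b i) x t)
      = pdx (pdx (sol.w i)) x t := by
  have h := sol.eq_w i x hx t ht
  have e1 : pdt (fun x t => sol.ρ x t * sol.w i x t) x t
      = pdt sol.ρ x t * sol.w i x t + sol.ρ x t * pdt (sol.w i) x t :=
    ((hd_t sol.smooth_ρ x t).mul (hd_t (sol.smooth_w i) x t)).deriv
  rw [e1] at h
  rw [← h]
  congr 1
  exact ((((hd_x sol.smooth_ρ x t).mul (hd_x sol.smooth_u x t)).mul
    (hd_x (sol.smooth_w i) x t)).sub (hd_x (sol.smooth_b i) x t)).deriv.symm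

lemma b' (i : Fin 2) {x t : ℝ} (hx : x ∈ Icc (0:ℝ) 1) (ht : t ∈ Icc (0:ℝ) T) :
    pdt (sol.b i) x t +
      (pdx sol.u x t * sol.b i x t + sol.u x t * pdx (sol.b i) x t - pdx (sol.w i) x t)
      = pdx (pdx (sol.b i)) x t := by
  have h := sol.eq_b i x hx t ht
  rw [← h]
  congr 1
  exact (((hd_x sol.smooth_u x t).mul
    (hd_x (sol.smooth_b i) x t)).sub (hd_x (sol.smooth_w i) x t)).deriv.symm

/-- Smooth expression for `(κ(θ)θ_x)_x`. -/
def kx (x t : ℝ) : ℝ :=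
  (pdt sol.ρ x t * sol.θ x t + sol.ρ x t * pdt sol.θ x t)
  + ((pdx sol.ρ x t * sol.u x t + sol.ρ x t * pdx sol.u x t) * sol.θ x t
      + sol.ρ x t * sol.u x t * pdx sol.θ x t)
  - ((pdx sol.u x t) ^ 2 + ((pdx (sol.w 0) x t) ^ 2 + (pdx (sol.w 1) x t) ^ 2)
    + ((pdx (sol.b 0) x t) ^ 2 + (pdx (sol.b 1) x t) ^ 2) - sol.ρ x t * sol.θ x t * pdx sol.u x t)

lemma kflux {q C₀ : ℝ} (hκ : KappaHyp q C₀ κ)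
    {x t : ℝ} (hx : x ∈ Icc (0:ℝ) 1) (ht : t ∈ Icc (0:ℝ) T) :
    HasDerivAt (fun y => κ (sol.θ y t) * pdx sol.θ y t) (kx sol x t) x := by
  have hd : DifferentiableAt ℝ κ (sol.θ x t) :=
    (hκ.1.differentiableOn (by norm_num)).differentiableAt (Ici_mem_nhds (sol.θ_pos x hx t ht))
  have h1 : HasDerivAt (fun y => κ (sol.θ y t)) _ x :=
    hd.hasDerivAt.comp x (hd_x sol.smooth_θ x t)
  have h2 := (h1.mul (hd_x (sm_pdx sol.smooth_θ) x t)).differentiableAt.hasDerivAt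
  have h := sol.eq_θ x hx t ht
  have e1 : pdt (fun x t => sol.ρ x t * sol.θ x t) x t
      = pdt sol.ρ x t * sol.θ x t + sol.ρ x t * pdt sol.θ x t :=
    ((hd_t sol.smooth_ρ x t).mul (hd_t sol.smooth_θ x t)).deriv
  have e2 : pdx (fun x t => sol.ρ x t * sol.u x t * sol.θ x t) x t =
      (pdx sol.ρ x t * sol.u x t + sol.ρ x t * pdx sol.u x t) * sol.θ x t
      + sol.ρ x t * sol.u x t * pdx sol.θ x t :=
    (((hd_x sol.smooth_ρ x t).mul (hd_x sol.smooth_u x t)).mul (hd_x sol.smooth_θ x t)).deriv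
  simp only [Fin.sum_univ_two] at h
  rw [e1, e2] at h
  refine h2.congr_deriv ?_
  have e3 : deriv ((fun y => κ (sol.θ y t)) * fun y => pdx sol.θ y t) x
    = pdx (fun x t => κ (sol.θ x t) * pdx sol.θ x t) x t := rfl
  rw [e3, kx]
  linarith

lemma c2 {f : ℝ → ℝ → ℝ} (hf : ContDiff ℝ (⊤ : ℕ∞) (Function.uncurry f)) :
    Continuous fun p : ℝ × ℝ => f p.1 p.2 := hf.continuous

lemma ckx : Continuous (Function.uncurry (kx sol)) := by
  have h1 := c2 sol.smooth_ρ
  have h2 := c2 sol.smooth_u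
  have h3 := c2 sol.smooth_θ
  have h4 := c2 (sm_pdt sol.smooth_ρ)
  have h5 := c2 (sm_pdt sol.smooth_θ)
  have h6 := c2 (sm_pdx sol.smooth_ρ)
  have h7 := c2 (sm_pdx sol.smooth_θ)
  have h8 := c2 (sm_pdx sol.smooth_u)
  have h9 := fun i => c2 (sm_pdx (sol.smooth_w i))
  have h10 := fun i => c2 (sm_pdx (sol.smooth_b i))
  show Continuous fun p : ℝ × ℝ => kx sol p.1 p.2
  unfold kx
  fun_prop

lemma sx {f : ℝ → ℝ → ℝ} (hf : ContDiff ℝ (⊤ : ℕ∞) (Function.uncurry f)) (t : ℝ) :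
    ContDiff ℝ (⊤ : ℕ∞) fun x => f x t :=
  hf.comp (contDiff_id.prodMk contDiff_const)

lemma st {f : ℝ → ℝ → ℝ} (hf : ContDiff ℝ (⊤ : ℕ∞) (Function.uncurry f)) (x : ℝ) :
    ContDiff ℝ (⊤ : ℕ∞) fun t => f x t :=
  hf.comp (contDiff_const.prodMk contDiff_id)

lemma mass_cons {t : ℝ} (ht : t ∈ Icc (0:ℝ) T) :
    ∫ x in (0:ℝ)..1, sol.ρ x t = ∫ x in (0:ℝ)..1, sol.ρ x 0 := by
  have h1 := c2 sol.smooth_ρ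
  have h2 := c2 sol.smooth_u
  have h4 := c2 (sm_pdt sol.smooth_ρ)
  have h6 := c2 (sm_pdx sol.smooth_ρ)
  have h8 := c2 (sm_pdx sol.smooth_u)
  have h := (cons_law (a := 1) (T := t) zero_le_one ht.1 sol.ρ (fun x t => sol.ρ x t * sol.u x t)
    (pdt sol.ρ) (fun x t => pdx sol.ρ x t * sol.u x t + sol.ρ x t * pdx sol.u x t)
    (fun x _ s _ => hd_t sol.smooth_ρ x s)
    (fun x _ s _ => (hd_x sol.smooth_ρ x s).mul (hd_x sol.smooth_u x s))
    h4.continuousOn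
    (Continuous.continuousOn (by unfold Function.uncurry; fun_prop))).2
  have z : ∀ s ∈ uIcc 0 t, ∫ x in (0:ℝ)..1, (pdt sol.ρ x s +
      (pdx sol.ρ x s * sol.u x s + sol.ρ x s * pdx sol.u x s)) = 0 := by
    intro s hs
    rw [uIcc_of_le ht.1] at hs
    rw [intervalIntegral.integral_congr (g := fun _ => 0)]
    · simp
    · intro x hx
      rw [uIcc_of_le zero_le_one] at hx
      exact mass' sol hx ⟨hs.1, hs.2.trans ht.2⟩
  have z2 : ∀ s ∈ uIcc 0 t, sol.ρ 1 s * sol.u 1 s - sol.ρ 0 s * sol.u 0 s = 0 := by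
    intro s hs
    rw [uIcc_of_le ht.1] at hs
    have := sol.bc_u s ⟨hs.1, hs.2.trans ht.2⟩
    rw [this.1, this.2]; ring
  rw [intervalIntegral.integral_congr z, intervalIntegral.integral_congr z2,
    intervalIntegral.integral_sub ((sx sol.smooth_ρ t).continuous.intervalIntegrable _ _)
      ((sx sol.smooth_ρ 0).continuous.intervalIntegrable _ _)] at h
  simp at h
  linarith

/-- energy density -/
def en (x t : ℝ) : ℝ :=
  sol.ρ x t * sol.θ x t + sol.ρ x t * (sol.u x t * sol.u x t) / 2
    + sol.ρ x t * (sol.w 0 x t * sol.w 0 x t + sol.w 1 x t * sol.w 1 x t) / 2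
    + (sol.b 0 x t * sol.b 0 x t + sol.b 1 x t * sol.b 1 x t) / 2

lemma cen : Continuous (Function.uncurry (en sol)) := by
  have h1 := c2 sol.smooth_ρ
  have h2 := c2 sol.smooth_u
  have h3 := c2 sol.smooth_θ
  have h9 := fun i => c2 ((sol.smooth_w i))
  have h10 := fun i => c2 ((sol.smooth_b i))
  show Continuous fun p : ℝ × ℝ => en sol p.1 p.2
  unfold en
  fun_prop

lemma cenx (t : ℝ) : Continuous (fun x => en sol x t) :=
  (cen sol).comp (continuous_id.prodMk continuous_const)

lemma energy_cons {q C₀ : ℝ} (hκ : KappaHyp q C₀ κ) {t : ℝ} (ht : t ∈ Icc (0:ℝ) T) :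
    ∫ x in (0:ℝ)..1, en sol x t = ∫ x in (0:ℝ)..1, en sol x 0 := by
  have h1 := c2 sol.smooth_ρ
  have h2 := c2 sol.smooth_u
  have h3 := c2 sol.smooth_θ
  have h4 := c2 (sm_pdt sol.smooth_ρ)
  have h5 := c2 (sm_pdt sol.smooth_θ)
  have h6 := c2 (sm_pdx sol.smooth_ρ)
  have h7 := c2 (sm_pdx sol.smooth_θ)
  have h8 := c2 (sm_pdx sol.smooth_u)
  have h8t := c2 (sm_pdt sol.smooth_u)
  have h8x := c2 (sm_pdx (sm_pdx sol.smooth_u))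
  have h9 := fun i => c2 (sm_pdx (sol.smooth_w i))
  have h9s := fun i => c2 (sol.smooth_w i)
  have h9t := fun i => c2 (sm_pdt (sol.smooth_w i))
  have h9x := fun i => c2 (sm_pdx (sm_pdx (sol.smooth_w i)))
  have h10 := fun i => c2 (sm_pdx (sol.smooth_b i))
  have h10s := fun i => c2 (sol.smooth_b i)
  have h10t := fun i => c2 (sm_pdt (sol.smooth_b i))
  have h10x := fun i => c2 (sm_pdx (sm_pdx (sol.smooth_b i)))
  have hk : Continuous fun p : ℝ × ℝ => kx sol p.1 p.2 := ckx sol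
  set ft : ℝ → ℝ → ℝ := fun x t =>
    (pdt sol.ρ x t * sol.θ x t + sol.ρ x t * pdt sol.θ x t)
    + (pdt sol.ρ x t * (sol.u x t * sol.u x t) / 2 + sol.ρ x t * (sol.u x t * pdt sol.u x t))
    + (pdt sol.ρ x t * (sol.w 0 x t * sol.w 0 x t + sol.w 1 x t * sol.w 1 x t) / 2
      + sol.ρ x t * (sol.w 0 x t * pdt (sol.w 0) x t + sol.w 1 x t * pdt (sol.w 1) x t))
    + (sol.b 0 x t * pdt (sol.b 0) x t + sol.b 1 x t * pdt (sol.b 1) x t) with hft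
  set enx : ℝ → ℝ → ℝ := fun x t =>
    (pdx sol.ρ x t * sol.θ x t + sol.ρ x t * pdx sol.θ x t)
    + (pdx sol.ρ x t * (sol.u x t * sol.u x t) / 2 + sol.ρ x t * (sol.u x t * pdx sol.u x t))
    + (pdx sol.ρ x t * (sol.w 0 x t * sol.w 0 x t + sol.w 1 x t * sol.w 1 x t) / 2
      + sol.ρ x t * (sol.w 0 x t * pdx (sol.w 0) x t + sol.w 1 x t * pdx (sol.w 1) x t))
    + (sol.b 0 x t * pdx (sol.b 0) x t + sol.b 1 x t * pdx (sol.b 1) x t) with henx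
  set g : ℝ → ℝ → ℝ := fun x t =>
    sol.u x t * (en sol x t + sol.ρ x t * sol.θ x t
      + (sol.b 0 x t * sol.b 0 x t + sol.b 1 x t * sol.b 1 x t) / 2)
    - (sol.w 0 x t * sol.b 0 x t + sol.w 1 x t * sol.b 1 x t)
    - κ (sol.θ x t) * pdx sol.θ x t
    - sol.u x t * pdx sol.u x t
    - (sol.w 0 x t * pdx (sol.w 0) x t + sol.w 1 x t * pdx (sol.w 1) x t)
    - (sol.b 0 x t * pdx (sol.b 0) x t + sol.b 1 x t * pdx (sol.b 1) x t) with hg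
  set gx : ℝ → ℝ → ℝ := fun x t =>
    pdx sol.u x t * (en sol x t + sol.ρ x t * sol.θ x t
      + (sol.b 0 x t * sol.b 0 x t + sol.b 1 x t * sol.b 1 x t) / 2)
    + sol.u x t * (enx x t + (pdx sol.ρ x t * sol.θ x t + sol.ρ x t * pdx sol.θ x t)
      + (sol.b 0 x t * pdx (sol.b 0) x t + sol.b 1 x t * pdx (sol.b 1) x t))
    - (pdx (sol.w 0) x t * sol.b 0 x t + sol.w 0 x t * pdx (sol.b 0) x t
      + (pdx (sol.w 1) x t * sol.b 1 x t + sol.w 1 x t * pdx (sol.b 1) x t))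
    - kx sol x t
    - (pdx sol.u x t * pdx sol.u x t + sol.u x t * pdx (pdx sol.u) x t)
    - ((pdx (sol.w 0) x t * pdx (sol.w 0) x t + sol.w 0 x t * pdx (pdx (sol.w 0)) x t)
      + (pdx (sol.w 1) x t * pdx (sol.w 1) x t + sol.w 1 x t * pdx (pdx (sol.w 1)) x t))
    - ((pdx (sol.b 0) x t * pdx (sol.b 0) x t + sol.b 0 x t * pdx (pdx (sol.b 0)) x t)
      + (pdx (sol.b 1) x t * pdx (sol.b 1) x t + sol.b 1 x t * pdx (pdx (sol.b 1)) x t)) with hgx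
  have D1 : ∀ x t, HasDerivAt (fun s => en sol x s) (ft x t) t := by
    intro x t
    have hρ := hd_t sol.smooth_ρ x t
    have hu := hd_t sol.smooth_u x t
    have hθ := hd_t sol.smooth_θ x t
    have hb := fun i => hd_t (sol.smooth_b i) x t
    have hw := fun i => hd_t (sol.smooth_w i) x t
    exact ((((hρ.mul hθ).add ((hρ.mul (hu.mul hu)).div_const 2)).add
      ((hρ.mul (((hw 0).mul (hw 0)).add ((hw 1).mul (hw 1)))).div_const 2)).add
      ((((hb 0).mul (hb 0)).add ((hb 1).mul (hb 1))).div_const 2)).congr_deriv (by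
        simp only [hft, Pi.mul_apply, Pi.add_apply]; ring)
  have D2 : ∀ x t, HasDerivAt (fun y => en sol y t) (enx x t) x := by
    intro x t
    have hρ := hd_x sol.smooth_ρ x t
    have hu := hd_x sol.smooth_u x t
    have hθ := hd_x sol.smooth_θ x t
    have hb := fun i => hd_x (sol.smooth_b i) x t
    have hw := fun i => hd_x (sol.smooth_w i) x t
    exact ((((hρ.mul hθ).add ((hρ.mul (hu.mul hu)).div_const 2)).add
      ((hρ.mul (((hw 0).mul (hw 0)).add ((hw 1).mul (hw 1)))).div_const 2)).add
      ((((hb 0).mul (hb 0)).add ((hb 1).mul (hb 1))).div_const 2)).congr_deriv (by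
        simp only [henx, Pi.mul_apply, Pi.add_apply]; ring)
  have D3 : ∀ x ∈ Icc (0:ℝ) 1, ∀ s ∈ Icc (0:ℝ) t, HasDerivAt (fun y => g y s) (gx x s) x := by
    intro x hx s hs
    have hρ := hd_x sol.smooth_ρ x s
    have hu := hd_x sol.smooth_u x s
    have hux := hd_x (sm_pdx sol.smooth_u) x s
    have hθ := hd_x sol.smooth_θ x s
    have hb := fun i => hd_x (sol.smooth_b i) x s
    have hw := fun i => hd_x (sol.smooth_w i) x s
    have hbx := fun i => hd_x (sm_pdx (sol.smooth_b i)) x s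
    have hwx := fun i => hd_x (sm_pdx (sol.smooth_w i)) x s
    have hK := kflux sol hκ hx (⟨hs.1, hs.2.trans ht.2⟩ : s ∈ Icc 0 T)
    exact ((((((hu.mul (((D2 x s).add (hρ.mul hθ)).add
      ((((hb 0).mul (hb 0)).add ((hb 1).mul (hb 1))).div_const 2))).sub
      (((hw 0).mul (hb 0)).add ((hw 1).mul (hb 1)))).sub hK).sub (hu.mul hux)).sub
      (((hw 0).mul (hwx 0)).add ((hw 1).mul (hwx 1)))).sub
      (((hb 0).mul (hbx 0)).add ((hb 1).mul (hbx 1)))).congr_deriv (by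
        simp only [hgx, Pi.mul_apply, Pi.add_apply]; ring)
  have hen : Continuous fun p : ℝ × ℝ => en sol p.1 p.2 := cen sol
  have h := (cons_law (a := 1) (T := t) zero_le_one ht.1 (en sol) g ft gx
    (fun x _ s _ => D1 x s) D3
    (Continuous.continuousOn (by unfold Function.uncurry; simp only [hft]; fun_prop))
    (Continuous.continuousOn (by unfold Function.uncurry; simp only [hgx, henx]; fun_prop))).2
  have z : ∀ s ∈ uIcc 0 t, ∫ x in (0:ℝ)..1, (ft x s + gx x s) = 0 := by
    intro s hs
    rw [uIcc_of_le ht.1] at hs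
    have hs' : s ∈ Icc 0 T := ⟨hs.1, hs.2.trans ht.2⟩
    rw [intervalIntegral.integral_congr (g := fun _ => 0)]
    · simp
    · intro x hx
      rw [uIcc_of_le zero_le_one] at hx
      have m0 := mass' sol hx hs'
      have m1 := mom' sol hx hs'
      have m2 := w' sol 0 hx hs'
      have m3 := w' sol 1 hx hs'
      have m4 := b' sol 0 hx hs'
      have m5 := b' sol 1 hx hs'
      simp only [hft, hgx, henx, kx, en]
      linear_combination sol.u x s * m1 + sol.w 0 x s * m2 + sol.w 1 x s * m3 +
        sol.b 0 x s * m4 + sol.b 1 x s * m5 - (sol.u x s ^ 2 / 2 + sol.w 0 x s ^ 2 / 2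
          + sol.w 1 x s ^ 2 / 2) * m0
  have z2 : ∀ s ∈ uIcc 0 t, g 1 s - g 0 s = 0 := by
    intro s hs
    rw [uIcc_of_le ht.1] at hs
    have hs' : s ∈ Icc 0 T := ⟨hs.1, hs.2.trans ht.2⟩
    have k1 := sol.bc_u s hs'
    have k2 := sol.bc_w 0 s hs'
    have k3 := sol.bc_w 1 s hs'
    have k4 := sol.bc_b 0 s hs'
    have k5 := sol.bc_b 1 s hs'
    have k6 := sol.bc_θ s hs'
    simp only [hg, k1, k2, k3, k4, k5, k6]
    ring
  rw [intervalIntegral.integral_congr z, intervalIntegral.integral_congr z2,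
    intervalIntegral.integral_sub ((cenx sol t).intervalIntegrable _ _)
      ((cenx sol 0).intervalIntegrable _ _)] at h
  simp at h
  linarith

end expand

section density
variable {T : ℝ} {κ : ℝ → ℝ} (sol : MHDSol T κ)

/-- effective flux -/
def gf (x t : ℝ) : ℝ :=
  sol.ρ x t * (sol.u x t) ^ 2 + sol.ρ x t * sol.θ x t
      + (∑ i, (sol.b i x t) ^ 2) / 2 - pdx sol.u x t

lemma cgf : Continuous fun p : ℝ × ℝ => gf sol p.1 p.2 := by
  have h1 := c2 sol.smooth_ρ
  have h2 := c2 sol.smooth_u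
  have h3 := c2 sol.smooth_θ
  have h8 := c2 (sm_pdx sol.smooth_u)
  have h10 := fun i => c2 ((sol.smooth_b i))
  unfold gf
  fun_prop

lemma cgft (x : ℝ) : Continuous fun t => gf sol x t :=
  (cgf sol).comp (continuous_const.prodMk continuous_id)

lemma cgfx (t : ℝ) : Continuous fun x => gf sol x t :=
  (cgf sol).comp (continuous_id.prodMk continuous_const)

lemma cru (t : ℝ) : Continuous fun x => sol.ρ x t * sol.u x t :=
  (sx sol.smooth_ρ t).continuous.mul (sx sol.smooth_u t).continuous

/-- potential -/
def phi (x t : ℝ) : ℝ :=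
  (∫ y in (0:ℝ)..x, sol.ρ y 0 * sol.u y 0) - ∫ s in (0:ℝ)..t, gf sol x s

lemma cphi : Continuous (Function.uncurry (phi sol)) := by
  show Continuous fun p : ℝ × ℝ => phi sol p.1 p.2
  unfold phi
  apply Continuous.sub
  · exact intervalIntegral.continuous_parametric_intervalIntegral_of_continuous
      (f := fun (_ : ℝ × ℝ) y => sol.ρ y 0 * sol.u y 0) (s := fun p : ℝ × ℝ => p.1)
      ((cru sol 0).comp continuous_snd) continuous_fst
  · exact intervalIntegral.continuous_parametric_intervalIntegral_of_continuous
      (f := fun (p : ℝ × ℝ) s => gf sol p.1 s) (s := fun p : ℝ × ℝ => p.2)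
      ((cgf sol).comp ((continuous_fst.comp continuous_fst).prodMk continuous_snd)) continuous_snd

lemma phi_id {x t : ℝ} (hx : x ∈ Icc (0:ℝ) 1) (ht : t ∈ Icc (0:ℝ) T) :
    phi sol x t = (∫ y in (0:ℝ)..x, sol.ρ y t * sol.u y t) - ∫ s in (0:ℝ)..t, gf sol 0 s := by
  have h1 := c2 sol.smooth_ρ
  have h2 := c2 sol.smooth_u
  have h3 := c2 sol.smooth_θ
  have h4 := c2 (sm_pdt sol.smooth_ρ)
  have h6 := c2 (sm_pdx sol.smooth_ρ)
  have h7 := c2 (sm_pdx sol.smooth_θ)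
  have h8 := c2 (sm_pdx sol.smooth_u)
  have h8t := c2 (sm_pdt sol.smooth_u)
  have h8x := c2 (sm_pdx (sm_pdx sol.smooth_u))
  have h10 := fun i => c2 (sm_pdx (sol.smooth_b i))
  have h10s := fun i => c2 (sol.smooth_b i)
  have h := (cons_law (a := x) (T := t) hx.1 ht.1 (fun x t => sol.ρ x t * sol.u x t)
    (gf sol) (fun x t => pdt sol.ρ x t * sol.u x t + sol.ρ x t * pdt sol.u x t)
    (fun x t => (pdx sol.ρ x t * (sol.u x t) ^ 2 + sol.ρ x t * (2 * sol.u x t * pdx sol.u x t)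
      + (pdx sol.ρ x t * sol.θ x t + sol.ρ x t * pdx sol.θ x t)
      + (sol.b 0 x t * pdx (sol.b 0) x t + sol.b 1 x t * pdx (sol.b 1) x t))
      - pdx (pdx sol.u) x t)
    (fun x _ s _ => (hd_t sol.smooth_ρ x s).mul (hd_t sol.smooth_u x s))
    (fun x _ s _ => (mom_x sol x s).sub (hd_x (sm_pdx sol.smooth_u) x s))
    (Continuous.continuousOn (by unfold Function.uncurry; fun_prop))
    (Continuous.continuousOn (by unfold Function.uncurry; fun_prop))).2
  have z : ∀ s ∈ uIcc 0 t, ∫ y in (0:ℝ)..x, ((pdt sol.ρ y s * sol.u y s +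
      sol.ρ y s * pdt sol.u y s) +
      ((pdx sol.ρ y s * (sol.u y s) ^ 2 + sol.ρ y s * (2 * sol.u y s * pdx sol.u y s)
      + (pdx sol.ρ y s * sol.θ y s + sol.ρ y s * pdx sol.θ y s)
      + (sol.b 0 y s * pdx (sol.b 0) y s + sol.b 1 y s * pdx (sol.b 1) y s))
      - pdx (pdx sol.u) y s)) = 0 := by
    intro s hs
    rw [uIcc_of_le ht.1] at hs
    rw [intervalIntegral.integral_congr (g := fun _ => 0)]
    · simp
    · intro y hy
      rw [uIcc_of_le hx.1] at hy
      have := mom' sol (x := y) (t := s) ⟨hy.1, hy.2.trans hx.2⟩ ⟨hs.1, hs.2.trans ht.2⟩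
      simp only
      linarith
  rw [intervalIntegral.integral_congr z,
    intervalIntegral.integral_sub ((cru sol t).intervalIntegrable _ _)
      ((cru sol 0).intervalIntegrable _ _),
    intervalIntegral.integral_sub ((cgft sol x).intervalIntegrable _ _)
      ((cgft sol 0).intervalIntegrable _ _)] at h
  simp at h
  unfold phi
  linarith

lemma en_ge {x t : ℝ} (hx : x ∈ Icc (0:ℝ) 1) (ht : t ∈ Icc (0:ℝ) T) :
    sol.ρ x t * sol.θ x t ≤ en sol x t ∧ sol.ρ x t * |sol.u x t| ≤ sol.ρ x t / 2 + en sol x t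
    ∧ gf sol x t ≤ 2 * en sol x t - pdx sol.u x t ∧ 0 ≤ en sol x t := by
  have hρ := sol.ρ_pos x hx t ht
  have hθ := sol.θ_pos x hx t ht
  have a1 : 0 ≤ sol.ρ x t * (sol.u x t * sol.u x t) / 2 :=
    div_nonneg (mul_nonneg hρ.le (mul_self_nonneg _)) (by norm_num)
  have a2 : 0 ≤ sol.ρ x t * (sol.w 0 x t * sol.w 0 x t + sol.w 1 x t * sol.w 1 x t) / 2 :=
    div_nonneg (mul_nonneg hρ.le (add_nonneg (mul_self_nonneg _) (mul_self_nonneg _)))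
      (by norm_num)
  have a3 : 0 ≤ (sol.b 0 x t * sol.b 0 x t + sol.b 1 x t * sol.b 1 x t) / 2 :=
    div_nonneg (add_nonneg (mul_self_nonneg _) (mul_self_nonneg _)) (by norm_num)
  have a4 : 0 < sol.ρ x t * sol.θ x t := mul_pos hρ hθ
  simp only [gf, en, Fin.sum_univ_two, pow_two]
  refine ⟨by linarith, ?_, by linarith, by linarith⟩
  have : sol.ρ x t * |sol.u x t| ≤ sol.ρ x t / 2 + sol.ρ x t * (sol.u x t * sol.u x t) / 2 := by
    have h1 : |sol.u x t| ≤ 1 / 2 + (sol.u x t * sol.u x t) / 2 := by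
      nlinarith [sq_nonneg (|sol.u x t| - 1), sq_abs (sol.u x t)]
    have := mul_le_mul_of_nonneg_left h1 hρ.le
    linarith
  linarith

lemma mom_bound {m E : ℝ} {t : ℝ} (ht : t ∈ Icc (0:ℝ) T)
    (hm : ∫ y in (0:ℝ)..1, sol.ρ y t ≤ m) (hE : ∫ y in (0:ℝ)..1, en sol y t ≤ E)
    {x : ℝ} (hx : x ∈ Icc (0:ℝ) 1) :
    |∫ y in (0:ℝ)..x, sol.ρ y t * sol.u y t| ≤ m / 2 + E := by
  have c1 := (sx sol.smooth_ρ t).continuous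
  calc |∫ y in (0:ℝ)..x, sol.ρ y t * sol.u y t|
      ≤ ∫ y in (0:ℝ)..x, |sol.ρ y t * sol.u y t| :=
        intervalIntegral.abs_integral_le_integral_abs hx.1
    _ ≤ ∫ y in (0:ℝ)..1, |sol.ρ y t * sol.u y t| :=
        intervalIntegral.integral_mono_interval le_rfl hx.1 hx.2
          (Filter.Eventually.of_forall fun _ => abs_nonneg _)
          ((cru sol t).abs.intervalIntegrable _ _)
    _ ≤ ∫ y in (0:ℝ)..1, (sol.ρ y t / 2 + en sol y t) := by
        apply intervalIntegral.integral_mono_on zero_le_one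
          ((cru sol t).abs.intervalIntegrable _ _)
          (((c1.div_const 2).add (cenx sol t)).intervalIntegrable _ _)
        intro y hy
        rw [abs_mul, abs_of_pos (sol.ρ_pos y hy t ht)]
        exact (en_ge sol hy ht).2.1
    _ = (∫ y in (0:ℝ)..1, sol.ρ y t) / 2 + ∫ y in (0:ℝ)..1, en sol y t := by
        rw [intervalIntegral.integral_add ((c1.div_const 2).intervalIntegrable _ _)
          ((cenx sol t).intervalIntegrable _ _), intervalIntegral.integral_div]
    _ ≤ _ := by linarith

lemma rho_bound {q C₀ : ℝ} (hκ : KappaHyp q C₀ κ) (hT : 0 ≤ T) {m E R : ℝ} (hR : 0 < R)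
    (hE0 : 0 ≤ E)
    (hm : ∫ y in (0:ℝ)..1, sol.ρ y 0 ≤ m) (hE : ∫ y in (0:ℝ)..1, en sol y 0 ≤ E)
    (h0 : ∀ x ∈ Icc (0:ℝ) 1, sol.ρ x 0 ≤ R) :
    ∀ x ∈ Icc (0:ℝ) 1, ∀ t ∈ Icc (0:ℝ) T,
      sol.ρ x t ≤ R * exp (4 * (m / 2 + E) + 2 * E * T) := by
  set K := m / 2 + E with hK
  have t0 : (0:ℝ) ∈ Icc 0 T := ⟨le_rfl, hT⟩
  have hmt : ∀ t ∈ Icc (0:ℝ) T, ∫ y in (0:ℝ)..1, sol.ρ y t ≤ m := fun t ht => by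
    rw [mass_cons sol ht]; exact hm
  have hEt : ∀ t ∈ Icc (0:ℝ) T, ∫ y in (0:ℝ)..1, en sol y t ≤ E := fun t ht => by
    rw [energy_cons sol hκ ht]; exact hE
  have hmb : ∀ x ∈ Icc (0:ℝ) 1, ∀ t ∈ Icc (0:ℝ) T,
      |∫ y in (0:ℝ)..x, sol.ρ y t * sol.u y t| ≤ K := fun x hx t ht =>
    mom_bound sol ht (hmt t ht) (hEt t ht) hx
  -- upper bound for `F`
  have up : ∀ x ∈ Icc (0:ℝ) 1, ∀ t ∈ Icc (0:ℝ) T, log (sol.ρ x t) + phi sol x t ≤ log R + K := by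
    apply max_princ hT (fun x t => log (sol.ρ x t) + phi sol x t) sol.u
      (fun x t => pdt sol.ρ x t / sol.ρ x t + (0 - gf sol x t))
      (fun x t => pdx sol.ρ x t / sol.ρ x t + sol.ρ x t * sol.u x t)
    · apply ContinuousOn.add _ (cphi sol).continuousOn
      apply ContinuousOn.log
      · exact (c2 sol.smooth_ρ).continuousOn
      · intro p hp
        exact (sol.ρ_pos p.1 hp.1 p.2 hp.2).ne'
    · intro x hx t ht
      refine ((hd_t sol.smooth_ρ x t).log (sol.ρ_pos x hx t ht).ne').add ?_
      exact (hasDerivAt_const t _).sub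
        ((cgft sol x).integral_hasStrictDerivAt 0 t).hasDerivAt
    · intro x hx t ht
      have hx' := Ioo_subset_Icc_self hx
      refine ((hd_x sol.smooth_ρ x t).log (sol.ρ_pos x hx' t ht).ne').add ?_
      have e : (fun y => phi sol y t) =ᶠ[nhds x] fun y =>
          (∫ y in (0:ℝ)..y, sol.ρ y t * sol.u y t) - ∫ s in (0:ℝ)..t, gf sol 0 s := by
        filter_upwards [Icc_mem_nhds hx.1 hx.2] with y hy
        exact phi_id sol hy ht
      refine HasDerivAt.congr_of_eventuallyEq ?_ e
      exact (((cru sol t).integral_hasStrictDerivAt 0 x).hasDerivAt).sub_const _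
    · exact sol.bc_u
    · intro x hx t ht
      have hρ := sol.ρ_pos x hx t ht
      have hθ := sol.θ_pos x hx t ht
      have m0 := mass' sol hx ht
      have e : pdt sol.ρ x t / sol.ρ x t + (0 - gf sol x t) + sol.u x t *
          (pdx sol.ρ x t / sol.ρ x t + sol.ρ x t * sol.u x t) =
          -(sol.ρ x t * sol.θ x t + (∑ i, (sol.b i x t) ^ 2) / 2) := by
        have : pdt sol.ρ x t / sol.ρ x t = - (pdx sol.ρ x t / sol.ρ x t * sol.u x t)
            - pdx sol.u x t := by
          field_simp
          linarith
        rw [this, gf]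
        ring
      rw [e]
      have : 0 < sol.ρ x t * sol.θ x t := mul_pos hρ hθ
      have : 0 ≤ (∑ i, (sol.b i x t) ^ 2) / 2 := by positivity
      linarith
    · intro x hx
      have h1 := Real.log_le_log (sol.ρ_pos x hx 0 t0) (h0 x hx)
      have h2 : phi sol x 0 = ∫ y in (0:ℝ)..x, sol.ρ y 0 * sol.u y 0 := by simp [phi]
      have h3 := (abs_le.1 (hmb x hx 0 t0)).2
      simp only [h2]
      linarith
  -- bound for the boundary term
  have bd : ∀ t ∈ Icc (0:ℝ) T, ∫ s in (0:ℝ)..t, gf sol 0 s ≤ 2 * K + 2 * E * T := by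
    intro t ht
    have p1 : ∀ y ∈ Icc (0:ℝ) 1, ∫ s in (0:ℝ)..t, gf sol 0 s ≤ 2 * K +
        ∫ s in (0:ℝ)..t, gf sol y s := by
      intro y hy
      have h1 := phi_id sol hy ht
      have h2 := (abs_le.1 (hmb y hy 0 t0)).1
      have h3 := (abs_le.1 (hmb y hy t ht)).2
      unfold phi at h1
      linarith
    have cI : Continuous fun y => ∫ s in (0:ℝ)..t, gf sol y s :=
      intervalIntegral.continuous_parametric_intervalIntegral_of_continuous' (cgf sol) 0 t
    have cI' : Continuous fun s => ∫ y in (0:ℝ)..1, gf sol y s :=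
      intervalIntegral.continuous_parametric_intervalIntegral_of_continuous'
        (f := fun s y => gf sol y s) ((cgf sol).comp continuous_swap) 0 1
    have p2 : ∫ _ in (0:ℝ)..1, (∫ s in (0:ℝ)..t, gf sol 0 s)
        ≤ ∫ y in (0:ℝ)..1, (2 * K + ∫ s in (0:ℝ)..t, gf sol y s) :=
      intervalIntegral.integral_mono_on zero_le_one
      (continuous_const.intervalIntegrable _ _)
      ((continuous_const.add cI).intervalIntegrable _ _) p1
    rw [intervalIntegral.integral_add (by simp) (cI.intervalIntegrable _ _),
      ← fubini_cont (gf sol) (cgf sol)] at p2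
    simp only [intervalIntegral.integral_const, sub_zero, one_smul] at p2
    have p3 : ∫ s in (0:ℝ)..t, ∫ y in (0:ℝ)..1, gf sol y s ≤ ∫ s in (0:ℝ)..t, 2 * E := by
      apply intervalIntegral.integral_mono_on ht.1 (cI'.intervalIntegrable _ _) (by simp)
      intro s hs
      have hs' : s ∈ Icc 0 T := ⟨hs.1, hs.2.trans ht.2⟩
      have cux := (sx (sm_pdx sol.smooth_u) s).continuous
      have q1 : ∫ y in (0:ℝ)..1, gf sol y s ≤ ∫ y in (0:ℝ)..1, (2 * en sol y s - pdx sol.u y s) := by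
        apply intervalIntegral.integral_mono_on zero_le_one
          ((cgfx sol s).intervalIntegrable _ _)
          (((continuous_const.mul (cenx sol s)).sub cux).intervalIntegrable _ _)
        intro y hy
        exact (en_ge sol hy hs').2.2.1
      have q2 : ∫ y in (0:ℝ)..1, pdx sol.u y s = 0 := by
        rw [intervalIntegral.integral_eq_sub_of_hasDerivAt (f := fun y => sol.u y s)
          (fun y _ => hd_x sol.smooth_u y s) (cux.intervalIntegrable _ _)]
        rw [(sol.bc_u s hs').1, (sol.bc_u s hs').2, sub_zero]
      rw [intervalIntegral.integral_sub
        (((cenx sol s).intervalIntegrable _ _).const_mul 2)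
        (cux.intervalIntegrable _ _), intervalIntegral.integral_const_mul, q2] at q1
      have := hEt s hs'
      linarith
    simp only [intervalIntegral.integral_const, sub_zero, smul_eq_mul] at p3
    have p4 : t * (2 * E) ≤ 2 * E * T := by nlinarith [ht.2]
    linarith
  intro x hx t ht
  have h1 := up x hx t ht
  have h2 := bd t ht
  have h3 := phi_id sol hx ht
  have h4 := (abs_le.1 (hmb x hx t ht)).1
  have h5 : log (sol.ρ x t) ≤ log R + (4 * K + 2 * E * T) := by linarith
  calc sol.ρ x t = exp (log (sol.ρ x t)) := (Real.exp_log (sol.ρ_pos x hx t ht)).symm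
    _ ≤ exp (log R + (4 * K + 2 * E * T)) := Real.exp_le_exp.2 h5
    _ = _ := by rw [Real.exp_add, Real.exp_log hR]

end density

section mainest
variable {T : ℝ} {κ : ℝ → ℝ} (sol : MHDSol T κ)

/-- spatial supremum of the temperature -/
def supθ (t : ℝ) : ℝ := sSup ((fun x => sol.θ x t) '' Icc (0:ℝ) 1)

lemma csup : Continuous (supθ sol) :=
  isCompact_Icc.continuous_sSup (f := fun t x => sol.θ x t)
    ((c2 sol.smooth_θ).comp continuous_swap)

lemma le_supθ {x : ℝ} (t : ℝ) (hx : x ∈ Icc (0:ℝ) 1) : sol.θ x t ≤ supθ sol t :=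
  le_csSup (isCompact_Icc.image (sx sol.smooth_θ t).continuous).bddAbove ⟨x, hx, rfl⟩

lemma supθ_pos {t : ℝ} (ht : t ∈ Icc (0:ℝ) T) : 0 < supθ sol t :=
  lt_of_lt_of_le (sol.θ_pos 0 (by simp) t ht) (le_supθ sol t (by simp))

lemma supθ_mem (t : ℝ) : ∃ x ∈ Icc (0:ℝ) 1, sol.θ x t = supθ sol t := by
  have := (isCompact_Icc.image (sx sol.smooth_θ t).continuous).sSup_mem
    ((nonempty_Icc.2 (zero_le_one' ℝ)).image _)
  obtain ⟨x, hx, h⟩ := this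
  exact ⟨x, hx, h⟩

lemma crpow (p : ℝ) {t : ℝ} (ht : t ∈ Icc (0:ℝ) T) :
    ContinuousOn (fun x => sol.θ x t ^ p) (Icc 0 1) :=
  (sx sol.smooth_θ t).continuous.continuousOn.rpow_const
    (fun x hx => Or.inl (sol.θ_pos x hx t ht).ne')

lemma sup_est {E M p : ℝ} (hM : 0 < M) (hp : 0 < p) {t : ℝ} (ht : t ∈ Icc (0:ℝ) T)
    (hm : M ≤ ∫ y in (0:ℝ)..1, sol.ρ y t) (hE : ∫ y in (0:ℝ)..1, en sol y t ≤ E) :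
    supθ sol t ^ p ≤ 2 * (E / M) ^ p +
      p ^ 2 / 2 * ∫ x in (0:ℝ)..1, (sol.θ x t ^ (p / 2 - 1) * pdx sol.θ x t) ^ 2 := by
  have cθ := (sx sol.smooth_θ t).continuous
  have cρ := (sx sol.smooth_ρ t).continuous
  obtain ⟨x0, hx0, hmin⟩ := isCompact_Icc.exists_isMinOn (nonempty_Icc.2 (zero_le_one' ℝ))
    cθ.continuousOn
  obtain ⟨x1, hx1, hmax⟩ := supθ_mem sol t
  have p0 := sol.θ_pos x0 hx0 t ht
  have hlow : sol.θ x0 t ≤ E / M := by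
    rw [le_div_iff₀ hM]
    calc sol.θ x0 t * M ≤ sol.θ x0 t * ∫ y in (0:ℝ)..1, sol.ρ y t := by gcongr
      _ = ∫ y in (0:ℝ)..1, sol.θ x0 t * sol.ρ y t := by
          rw [intervalIntegral.integral_const_mul]
      _ ≤ ∫ y in (0:ℝ)..1, en sol y t := by
          apply intervalIntegral.integral_mono_on zero_le_one
            ((cρ.intervalIntegrable _ _).const_mul _)
            ((cenx sol t).intervalIntegrable _ _)
          intro y hy
          refine le_trans ?_ (en_ge sol hy ht).1
          have h1 : sol.θ x0 t ≤ sol.θ y t := hmin hy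
          have h2 := sol.ρ_pos y hy t ht
          rw [mul_comm (sol.ρ y t)]
          exact mul_le_mul_of_nonneg_right h1 h2.le
      _ ≤ E := hE
  set h : ℝ → ℝ := fun x => sol.θ x t ^ (p / 2 - 1) * pdx sol.θ x t with hh
  have ch : ContinuousOn h (Icc 0 1) :=
    (crpow sol _ ht).mul (sx (sm_pdx sol.smooth_θ) t).continuous.continuousOn
  have usub : uIcc x0 x1 ⊆ Icc 0 1 := uIcc_subset_Icc hx0 hx1
  have ftc : ∫ x in x0..x1, p / 2 * h x = sol.θ x1 t ^ (p / 2) - sol.θ x0 t ^ (p / 2) := by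
    apply intervalIntegral.integral_eq_sub_of_hasDerivAt (f := fun x => sol.θ x t ^ (p / 2))
    · intro x hx
      exact ((hd_x sol.smooth_θ x t).rpow_const
        (Or.inl (sol.θ_pos x (usub hx) t ht).ne')).congr_deriv (by simp only [hh]; ring)
    · exact ((ch.mono usub).intervalIntegrable).const_mul _
  have hle : ∫ x in x0..x1, p / 2 * h x ≤ p / 2 * ∫ x in (0:ℝ)..1, |h x| := by
    rw [intervalIntegral.integral_const_mul]
    refine mul_le_mul_of_nonneg_left ?_ (by positivity)
    refine (le_abs_self _).trans ?_
    rw [← Real.norm_eq_abs]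
    refine (intervalIntegral.norm_integral_le_integral_norm_uIoc).trans ?_
    rw [intervalIntegral.integral_of_le (by norm_num : (0:ℝ) ≤ 1)]
    simp only [Real.norm_eq_abs]
    apply setIntegral_mono_set
    · have : IntervalIntegrable (fun x => |h x|) volume 0 1 :=
        ContinuousOn.intervalIntegrable (by rw [uIcc_of_le zero_le_one]; exact ch.abs)
      exact this.1
    · exact Filter.Eventually.of_forall (fun _ => abs_nonneg _)
    · apply LE.le.eventuallyLE
      intro z hz
      rcases le_total x0 x1 with hca | hca
      · rw [uIoc_of_le hca] at hz
        exact ⟨lt_of_le_of_lt hx0.1 hz.1, hz.2.trans hx1.2⟩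
      · rw [uIoc_of_ge hca] at hz
        exact ⟨lt_of_le_of_lt hx1.1 hz.1, hz.2.trans hx0.2⟩
  have cs := cs01 ch
  have e1 : supθ sol t ^ p = (sol.θ x1 t ^ (p / 2)) ^ 2 := by
    rw [← hmax, ← Real.rpow_natCast, ← Real.rpow_mul (sol.θ_pos x1 hx1 t ht).le]
    congr 1; push_cast; ring
  have e2 : (sol.θ x0 t ^ (p / 2)) ^ 2 ≤ (E / M) ^ p := by
    have : (sol.θ x0 t ^ (p / 2)) ^ 2 = sol.θ x0 t ^ p := by
      rw [← Real.rpow_natCast, ← Real.rpow_mul p0.le]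
      congr 1; push_cast; ring
    rw [this]
    exact Real.rpow_le_rpow p0.le hlow hp.le
  have i0 : 0 ≤ ∫ x in (0:ℝ)..1, |h x| :=
    intervalIntegral.integral_nonneg zero_le_one (fun _ _ => abs_nonneg _)
  set I := ∫ x in (0:ℝ)..1, |h x|
  set J := ∫ x in (0:ℝ)..1, h x ^ 2
  have a0 : 0 ≤ sol.θ x0 t ^ (p / 2) := by positivity
  have a1 : 0 ≤ sol.θ x1 t ^ (p / 2) := Real.rpow_nonneg (sol.θ_pos x1 hx1 t ht).le _
  rw [e1]
  set X := sol.θ x1 t ^ (p / 2)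
  set Y := sol.θ x0 t ^ (p / 2)
  have hX : X ≤ Y + p / 2 * I := by linarith
  calc X ^ 2 ≤ (Y + p / 2 * I) ^ 2 := pow_le_pow_left₀ a1 hX 2
    _ ≤ 2 * Y ^ 2 + p ^ 2 / 2 * I ^ 2 := by nlinarith [sq_nonneg (Y - p / 2 * I)]
    _ ≤ 2 * (E / M) ^ p + p ^ 2 / 2 * J := by
        have : p ^ 2 / 2 * I ^ 2 ≤ p ^ 2 / 2 * J :=
          mul_le_mul_of_nonneg_left cs (by positivity)
        linarith

set_option maxHeartbeats 1600000 in
lemma main_est {q C₀ α : ℝ} (hκ : KappaHyp q C₀ κ) (hC₀ : 1 ≤ C₀) (hT : 0 ≤ T)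
    (hα : 0 < α) (hα1 : α < 1) (hpq : 0 < q - α + 1) {m E M R : ℝ} (hM : 0 < M)
    (hm : ∫ y in (0:ℝ)..1, sol.ρ y 0 ≤ m) (hMm : M ≤ ∫ y in (0:ℝ)..1, sol.ρ y 0)
    (hE : ∫ y in (0:ℝ)..1, en sol y 0 ≤ E) (hR0 : 0 ≤ R)
    (hR : ∀ x ∈ Icc (0:ℝ) 1, ∀ t ∈ Icc (0:ℝ) T, sol.ρ x t ≤ R) :
    ∫ t in (0:ℝ)..T, (α / C₀ * (2 / (q - α + 1) ^ 2) *
      (supθ sol t ^ (q - α + 1) - 2 * (E / M) ^ (q - α + 1))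
      - R * E / 4 * supθ sol t ^ (1 - α)) ≤ (m + E) / (1 - α) := by
  have t0 : (0:ℝ) ∈ Icc 0 T := ⟨le_rfl, hT⟩
  have tT : T ∈ Icc 0 T := ⟨hT, le_rfl⟩
  have h1 := c2 sol.smooth_ρ
  have h2 := c2 sol.smooth_u
  have h3 := c2 sol.smooth_θ
  have h4 := c2 (sm_pdt sol.smooth_ρ)
  have h5 := c2 (sm_pdt sol.smooth_θ)
  have h6 := c2 (sm_pdx sol.smooth_ρ)
  have h7 := c2 (sm_pdx sol.smooth_θ)
  have h8 := c2 (sm_pdx sol.smooth_u)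
  have hk : Continuous fun p : ℝ × ℝ => kx sol p.1 p.2 := ckx sol
  have hα1' : (1 - α) ≠ 0 := by linarith
  have cr : ∀ r : ℝ, ContinuousOn (fun p : ℝ × ℝ => sol.θ p.1 p.2 ^ r) (Icc 0 1 ×ˢ Icc 0 T) :=
    fun r => h3.continuousOn.rpow_const (fun p hp => Or.inl (sol.θ_pos p.1 hp.1 p.2 hp.2).ne')
  have ck : ContinuousOn (fun p : ℝ × ℝ => κ (sol.θ p.1 p.2)) (Icc 0 1 ×ˢ Icc 0 T) :=
    hκ.1.continuousOn.comp h3.continuousOn (fun p hp => (sol.θ_pos p.1 hp.1 p.2 hp.2).le)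
  have hmT : ∫ y in (0:ℝ)..1, sol.ρ y T ≤ m := by rw [mass_cons sol tT]; exact hm
  have hET : ∫ y in (0:ℝ)..1, en sol y T ≤ E := by rw [energy_cons sol hκ tT]; exact hE
  set f : ℝ → ℝ → ℝ := fun x t => sol.ρ x t * sol.θ x t ^ (1 - α) / (1 - α) with hf
  set ft : ℝ → ℝ → ℝ := fun x t => (pdt sol.ρ x t * sol.θ x t ^ (1 - α)
    + sol.ρ x t * (pdt sol.θ x t * (1 - α) * sol.θ x t ^ (1 - α - 1))) / (1 - α) with hft
  set g : ℝ → ℝ → ℝ := fun x t => sol.ρ x t * sol.u x t * sol.θ x t ^ (1 - α) / (1 - α)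
    - κ (sol.θ x t) * pdx sol.θ x t * sol.θ x t ^ (-α) with hg
  set gx : ℝ → ℝ → ℝ := fun x t => ((pdx sol.ρ x t * sol.u x t + sol.ρ x t * pdx sol.u x t)
      * sol.θ x t ^ (1 - α)
    + sol.ρ x t * sol.u x t * (pdx sol.θ x t * (1 - α) * sol.θ x t ^ (1 - α - 1))) / (1 - α)
    - (kx sol x t * sol.θ x t ^ (-α)
      + κ (sol.θ x t) * pdx sol.θ x t * (pdx sol.θ x t * (-α) * sol.θ x t ^ (-α - 1))) with hgx
  obtain ⟨hgi, h⟩ := cons_law (a := 1) (T := T) zero_le_one hT f g ft gx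
    (fun x hx t ht => ((hd_t sol.smooth_ρ x t).mul ((hd_t sol.smooth_θ x t).rpow_const
      (Or.inl (sol.θ_pos x hx t ht).ne'))).div_const _)
    (fun x hx t ht => ((((hd_x sol.smooth_ρ x t).mul (hd_x sol.smooth_u x t)).mul
      ((hd_x sol.smooth_θ x t).rpow_const (Or.inl (sol.θ_pos x hx t ht).ne'))).div_const _).sub
      ((kflux sol hκ hx ht).mul
      ((hd_x sol.smooth_θ x t).rpow_const (Or.inl (sol.θ_pos x hx t ht).ne'))))
    (by
      unfold Function.uncurry
      simp only [hft]
      have := cr (1 - α)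
      have := cr (1 - α - 1)
      fun_prop)
    (by
      unfold Function.uncurry
      simp only [hgx]
      exact ((((((h6.mul h2).add (h1.mul h8)).continuousOn.mul (cr (1 - α))).add
        ((h1.mul h2).continuousOn.mul ((h7.mul continuous_const).continuousOn.mul
          (cr (1 - α - 1))))).div_const _).sub
        ((hk.continuousOn.mul (cr (-α))).add ((ck.mul h7.continuousOn).mul
          ((h7.mul continuous_const).continuousOn.mul (cr (-α - 1)))))))
  have z2 : ∀ s ∈ uIcc 0 T, g 1 s - g 0 s = 0 := by
    intro s hs
    rw [uIcc_of_le hT] at hs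
    have k1 := sol.bc_u s hs
    have k6 := sol.bc_θ s hs
    simp only [hg, k1, k6]
    ring
  rw [intervalIntegral.integral_congr z2] at h
  simp only [intervalIntegral.integral_zero, add_zero] at h
  have cfT : ∀ t ∈ Icc (0:ℝ) T, ContinuousOn (fun x => f x t) (Icc 0 1) := fun t ht =>
    (((sx sol.smooth_ρ t).continuous.continuousOn).mul (crpow sol _ ht)).div_const _
  have u01 : uIcc (0:ℝ) 1 = Icc 0 1 := uIcc_of_le zero_le_one
  have up : ∫ x in (0:ℝ)..1, (f x T - f x 0) ≤ (m + E) / (1 - α) := by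
    have cR : Continuous fun x => (sol.ρ x T + en sol x T) / (1 - α) :=
      (((sx sol.smooth_ρ T).continuous).add (cenx sol T)).div_const _
    calc ∫ x in (0:ℝ)..1, (f x T - f x 0)
        ≤ ∫ x in (0:ℝ)..1, (sol.ρ x T + en sol x T) / (1 - α) := by
          apply intervalIntegral.integral_mono_on zero_le_one
          · exact ContinuousOn.intervalIntegrable (by
              rw [u01]; exact (cfT T tT).sub (cfT 0 t0))
          · exact cR.intervalIntegrable _ _
          · intro x hx
            have r0 := sol.ρ_pos x hx 0 t0
            have rT := sol.ρ_pos x hx T tT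
            have s0 := sol.θ_pos x hx 0 t0
            have sT := sol.θ_pos x hx T tT
            have f0 : 0 ≤ f x 0 := by
              simp only [hf]
              exact div_nonneg (mul_nonneg r0.le (Real.rpow_nonneg s0.le _)) (by linarith)
            have b1 : sol.θ x T ^ (1 - α) ≤ 1 + sol.θ x T := by
              rcases le_total (sol.θ x T) 1 with hca | hca
              · have := Real.rpow_le_one sT.le hca (by linarith : 0 ≤ 1 - α)
                linarith
              · have := Real.rpow_le_rpow_of_exponent_le hca (by linarith : 1 - α ≤ 1)
                rw [Real.rpow_one] at this
                linarith
            have b2 : f x T ≤ (sol.ρ x T + en sol x T) / (1 - α) := by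
              simp only [hf]
              apply div_le_div_of_nonneg_right _ (by linarith)
              have := mul_le_mul_of_nonneg_left b1 rT.le
              have := (en_ge sol hx tT).1
              linarith
            linarith
      _ = ((∫ x in (0:ℝ)..1, sol.ρ x T) + ∫ x in (0:ℝ)..1, en sol x T) / (1 - α) := by
          rw [intervalIntegral.integral_div, intervalIntegral.integral_add
            ((sx sol.smooth_ρ T).continuous.intervalIntegrable _ _)
            ((cenx sol T).intervalIntegrable _ _)]
      _ ≤ _ := by
          apply div_le_div_of_nonneg_right _ (by linarith)
          linarith
  rw [← h] at up
  refine le_trans ?_ up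
  have cs := csup sol
  apply intervalIntegral.integral_mono_on hT _ hgi
  · -- pointwise in time
    intro t ht
    have hS := supθ_pos sol ht
    have hMt : M ≤ ∫ y in (0:ℝ)..1, sol.ρ y t := by rw [mass_cons sol ht]; exact hMm
    have hEt : ∫ y in (0:ℝ)..1, en sol y t ≤ E := by rw [energy_cons sol hκ ht]; exact hE
    have se := sup_est sol hM hpq ht hMt hEt
    set p := q - α + 1 with hp
    set J := ∫ x in (0:ℝ)..1, (sol.θ x t ^ (p / 2 - 1) * pdx sol.θ x t) ^ 2 with hJ
    have cJ : ContinuousOn (fun x => (sol.θ x t ^ (p / 2 - 1) * pdx sol.θ x t) ^ 2) (Icc 0 1) :=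
      ((crpow sol _ ht).mul (sx (sm_pdx sol.smooth_θ) t).continuous.continuousOn).pow 2
    have iJ : IntervalIntegrable (fun x => (sol.θ x t ^ (p / 2 - 1) * pdx sol.θ x t) ^ 2)
      volume 0 1 := ContinuousOn.intervalIntegrable (by rw [u01]; exact cJ)
    have key : ∀ x ∈ Icc (0:ℝ) 1, α / C₀ * (sol.θ x t ^ (p / 2 - 1) * pdx sol.θ x t) ^ 2
        - R / 4 * supθ sol t ^ (1 - α) * en sol x t ≤ ft x t + gx x t := by
      intro x hx
      have r := sol.ρ_pos x hx t ht
      have s := sol.θ_pos x hx t ht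
      have m0 := mass' sol hx ht
      set z := sol.θ x t ^ (-α) with hz
      have z0 : 0 < z := Real.rpow_pos_of_pos s _
      have e1 : sol.θ x t ^ (1 - α) = sol.θ x t * z := by
        rw [sub_eq_add_neg, Real.rpow_add s, Real.rpow_one]
      have e2 : sol.θ x t ^ (1 - α - 1) = z := by
        rw [hz]; congr 1; ring
      have e3 : (sol.θ x t ^ (p / 2 - 1) * pdx sol.θ x t) ^ 2
          = sol.θ x t ^ q * sol.θ x t ^ (-α - 1) * (pdx sol.θ x t) ^ 2 := by
        rw [mul_pow, ← Real.rpow_natCast, ← Real.rpow_mul s.le, ← Real.rpow_add s]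
        congr 2
        push_cast; rw [hp]; ring
      have e4 : ft x t + gx x t = z * ((pdx sol.u x t) ^ 2 + ((pdx (sol.w 0) x t) ^ 2
          + (pdx (sol.w 1) x t) ^ 2) + ((pdx (sol.b 0) x t) ^ 2 + (pdx (sol.b 1) x t) ^ 2)
          - sol.ρ x t * sol.θ x t * pdx sol.u x t)
          + α * (κ (sol.θ x t) * (sol.θ x t ^ (-α - 1) * (pdx sol.θ x t) ^ 2)) := by
        simp only [hft, hgx, e1, e2, kx, ← hz]
        field_simp
        linear_combination (sol.θ x t * α * z) * m0
      have y0 : 0 < sol.θ x t ^ (-α - 1) := Real.rpow_pos_of_pos s _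
      have k1 : C₀⁻¹ * sol.θ x t ^ q ≤ κ (sol.θ x t) := by
        refine le_trans ?_ (hκ.2.1 _ s.le)
        gcongr
        linarith
      have k2 : α / C₀ * (sol.θ x t ^ (p / 2 - 1) * pdx sol.θ x t) ^ 2
          ≤ α * (κ (sol.θ x t) * (sol.θ x t ^ (-α - 1) * (pdx sol.θ x t) ^ 2)) := by
        rw [e3]
        have := mul_le_mul_of_nonneg_right k1
          (by positivity : 0 ≤ sol.θ x t ^ (-α - 1) * (pdx sol.θ x t) ^ 2)
        have := mul_le_mul_of_nonneg_left this hα.le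
        refine le_trans (le_of_eq ?_) this
        rw [div_eq_mul_inv]; ring
      have k3 : z * (sol.ρ x t * sol.θ x t) ^ 2 / 4 ≤ R / 4 * supθ sol t ^ (1 - α) * en sol x t := by
        have a1 : sol.θ x t * z ≤ supθ sol t ^ (1 - α) := by
          rw [← e1]
          exact Real.rpow_le_rpow s.le (le_supθ sol t hx) (by linarith)
        have a2 := (en_ge sol hx ht).1
        have a3 := hR x hx t ht
        have a4 : sol.ρ x t * (sol.θ x t * z) ≤ R * supθ sol t ^ (1 - α) :=
          mul_le_mul a3 a1 (by positivity) hR0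
        have a5 : sol.ρ x t * (sol.θ x t * z) * (sol.ρ x t * sol.θ x t)
            ≤ R * supθ sol t ^ (1 - α) * en sol x t :=
          mul_le_mul a4 a2 (by positivity) (by positivity)
        have a6 : z * (sol.ρ x t * sol.θ x t) ^ 2
            = sol.ρ x t * (sol.θ x t * z) * (sol.ρ x t * sol.θ x t) := by ring
        linarith
      have k4 : -(z * (sol.ρ x t * sol.θ x t) ^ 2 / 4) ≤ z * ((pdx sol.u x t) ^ 2
          + ((pdx (sol.w 0) x t) ^ 2
          + (pdx (sol.w 1) x t) ^ 2) + ((pdx (sol.b 0) x t) ^ 2 + (pdx (sol.b 1) x t) ^ 2)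
          - sol.ρ x t * sol.θ x t * pdx sol.u x t) := by
        have : -((sol.ρ x t * sol.θ x t) ^ 2 / 4) ≤ ((pdx sol.u x t) ^ 2
          + ((pdx (sol.w 0) x t) ^ 2
          + (pdx (sol.w 1) x t) ^ 2) + ((pdx (sol.b 0) x t) ^ 2 + (pdx (sol.b 1) x t) ^ 2)
          - sol.ρ x t * sol.θ x t * pdx sol.u x t) := by
          linarith [sq_nonneg (pdx sol.u x t - sol.ρ x t * sol.θ x t / 2),
            sq_nonneg (pdx (sol.w 0) x t), sq_nonneg (pdx (sol.w 1) x t),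
            sq_nonneg (pdx (sol.b 0) x t), sq_nonneg (pdx (sol.b 1) x t)]
        have := mul_le_mul_of_nonneg_left this z0.le
        linarith
      rw [e4]
      linarith
    have hcf : ContinuousOn (fun x => ft x t + gx x t) (Icc 0 1) := by
      have c1 := (sx sol.smooth_ρ t).continuous
      have c3 := (sx sol.smooth_u t).continuous
      have c4 := (sx (sm_pdt sol.smooth_ρ) t).continuous
      have c5 := (sx (sm_pdt sol.smooth_θ) t).continuous
      have c6 := (sx (sm_pdx sol.smooth_ρ) t).continuous
      have c7 := (sx (sm_pdx sol.smooth_θ) t).continuous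
      have c8 := (sx (sm_pdx sol.smooth_u) t).continuous
      have c9 : Continuous fun x => kx sol x t :=
        hk.comp (continuous_id.prodMk continuous_const)
      have c10 : ContinuousOn (fun x => κ (sol.θ x t)) (Icc 0 1) :=
        hκ.1.continuousOn.comp (sx sol.smooth_θ t).continuous.continuousOn
          (fun x hx => (sol.θ_pos x hx t ht).le)
      have d1 := crpow sol (1 - α) ht
      have d2 := crpow sol (1 - α - 1) ht
      have d3 := crpow sol (-α) ht
      have d4 := crpow sol (-α - 1) ht
      simp only [hft, hgx]
      exact (((c4.continuousOn.mul d1).add (c1.continuousOn.mul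
        ((c5.mul continuous_const).continuousOn.mul d2))).div_const _).add
        ((((((c6.mul c3).add (c1.mul c8)).continuousOn.mul d1).add
        ((c1.mul c3).continuousOn.mul ((c7.mul continuous_const).continuousOn.mul
          d2))).div_const _).sub
        ((c9.continuousOn.mul d3).add ((c10.mul c7.continuousOn).mul
          ((c7.mul continuous_const).continuousOn.mul d4))))
    have cen' := (cenx sol t).intervalIntegrable (μ := volume) 0 1
    have k : ∫ x in (0:ℝ)..1, (α / C₀ * (sol.θ x t ^ (p / 2 - 1) * pdx sol.θ x t) ^ 2
        - R / 4 * supθ sol t ^ (1 - α) * en sol x t) ≤ ∫ x in (0:ℝ)..1, (ft x t + gx x t) :=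
      intervalIntegral.integral_mono_on zero_le_one
      ((iJ.const_mul (α / C₀)).sub (cen'.const_mul (R / 4 * supθ sol t ^ (1 - α))))
      (ContinuousOn.intervalIntegrable (by rw [u01]; exact hcf)) key
    rw [intervalIntegral.integral_sub (iJ.const_mul _) (cen'.const_mul _),
      intervalIntegral.integral_const_mul, intervalIntegral.integral_const_mul, ← hJ] at k
    refine le_trans ?_ k
    have k5 : α / C₀ * (2 / p ^ 2) * (supθ sol t ^ p - 2 * (E / M) ^ p) ≤ α / C₀ * J := by
      rw [mul_assoc]
      refine mul_le_mul_of_nonneg_left ?_ (by positivity)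
      rw [div_mul_eq_mul_div, div_le_iff₀ (by positivity)]
      linarith
    have k6 : R / 4 * supθ sol t ^ (1 - α) * (∫ x in (0:ℝ)..1, en sol x t)
        ≤ R / 4 * supθ sol t ^ (1 - α) * E :=
      mul_le_mul_of_nonneg_left hEt (by positivity)
    linarith
  · apply Continuous.intervalIntegrable
    apply Continuous.sub
    · exact continuous_const.mul ((cs.rpow_const fun _ => Or.inr hpq.le).sub continuous_const)
    · exact continuous_const.mul (cs.rpow_const fun _ => Or.inr (by linarith))

end mainest

/-- Lemma 2.3, estimate (2.5): for any `0 < α < min{1, q}` there is a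
constant `C` depending only on `α, T, q, C₀` and on the initial data (upper bound `A`
for the `H²` norms, upper bound `B` for `∫₀¹ ρ₀(|ln ρ₀| + |ln θ₀|) dx`, positive lower
bound `M` for `∫₀¹ ρ₀ dx`), but not on the pointwise lower bounds of `ρ₀` and `θ₀`,
such that every smooth solution satisfies
`∫₀ᵀ (sup_{x ∈ [0,1]} θ(x,t))^{q−α+1} dt ≤ C`. -/
theorem stmt10 (T q C₀ : ℝ) (hT : 0 < T) (hq : 0 < q) (hC₀ : 1 ≤ C₀)
    (κ : ℝ → ℝ) (hκ : KappaHyp q C₀ κ)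
    (α : ℝ) (hα : 0 < α) (hα' : α < min 1 q) (A B M : ℝ) (hM : 0 < M) :
    ∃ C : ℝ, 0 < C ∧ ∀ sol : MHDSol T κ, InitBounds sol A B M →
      (∫ s in (0:ℝ)..T,
          (sSup ((fun x => sol.θ x s) '' Set.Icc (0:ℝ) 1)) ^ (q - α + 1)) ≤ C := by
  have hα1 : α < 1 := hα'.trans_le (min_le_left _ _)
  have hp : 0 < q - α + 1 := by linarith
  set S : ℝ := 1 + A ^ 2 with hS
  have hS0 : 0 < S := by positivity
  set E : ℝ := 2 * S ^ 2 + 3 * S ^ 3 / 2 with hEd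
  have hE0 : 0 ≤ E := by positivity
  set R : ℝ := S * exp (4 * (S / 2 + E) + 2 * E * T) with hRd
  have hR0 : 0 ≤ R := by positivity
  set p := q - α + 1 with hpd
  set c1 : ℝ := α / C₀ * (2 / p ^ 2) with hc1
  have c10 : 0 < c1 := by positivity
  set c2' : ℝ := 2 * (E / M) ^ p with hc2
  have c20 : 0 ≤ c2' := by positivity
  set c3 : ℝ := R * E / 4 with hc3
  have c30 : 0 ≤ c3 := by positivity
  obtain ⟨c5, c50, hy⟩ := young_abs (r := 1 - α) (q := q) (δ := c1 / (2 * (c3 + 1)))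
    (by linarith) hq (by positivity)
  refine ⟨2 / c1 * ((S + E) / (1 - α) + T * (c1 * c2' + c3 * c5)) + 1, ?_, ?_⟩
  · have : 0 < 1 - α := by linarith
    positivity
  intro sol ⟨i1, i2, i3, i4, i5, _, i7⟩
  have t0 : (0:ℝ) ∈ Icc 0 T := ⟨le_rfl, hT.le⟩
  have bρ : ∀ x ∈ Icc (0:ℝ) 1, sol.ρ x 0 ≤ S := fun x hx =>
    (le_abs_self _).trans (sob (sx sol.smooth_ρ 0) i1 hx)
  have bθ : ∀ x ∈ Icc (0:ℝ) 1, sol.θ x 0 ≤ S := fun x hx =>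
    (le_abs_self _).trans (sob (sx sol.smooth_θ 0) i3 hx)
  have sqb : ∀ {y : ℝ}, |y| ≤ S → y * y ≤ S ^ 2 := by
    intro y hy
    have := pow_le_pow_left₀ (abs_nonneg y) hy 2
    rw [sq_abs] at this
    linarith
  have bu : ∀ x ∈ Icc (0:ℝ) 1, sol.u x 0 * sol.u x 0 ≤ S ^ 2 := fun x hx =>
    sqb (sob (sx sol.smooth_u 0) i2 hx)
  have bw : ∀ i, ∀ x ∈ Icc (0:ℝ) 1, sol.w i x 0 * sol.w i x 0 ≤ S ^ 2 := fun i x hx =>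
    sqb (sob (sx (sol.smooth_w i) 0) (i4 i) hx)
  have bb : ∀ i, ∀ x ∈ Icc (0:ℝ) 1, sol.b i x 0 * sol.b i x 0 ≤ S ^ 2 := fun i x hx =>
    sqb (sob (sx (sol.smooth_b i) 0) (i5 i) hx)
  have hm : ∫ y in (0:ℝ)..1, sol.ρ y 0 ≤ S := by
    have := intervalIntegral.integral_mono_on (a := 0) (b := 1) (g := fun _ => S) zero_le_one
      ((sx sol.smooth_ρ 0).continuous.intervalIntegrable (μ := volume) _ _)
      (continuous_const.intervalIntegrable _ _) bρ
    simpa using this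
  have hE : ∫ y in (0:ℝ)..1, en sol y 0 ≤ E := by
    have := intervalIntegral.integral_mono_on (a := 0) (b := 1) (g := fun _ => E) zero_le_one
      ((cenx sol 0).intervalIntegrable (μ := volume) _ _)
      (continuous_const.intervalIntegrable _ _) (by
        intro x hx
        have r := sol.ρ_pos x hx 0 t0
        have s := sol.θ_pos x hx 0 t0
        have a1 : sol.ρ x 0 * sol.θ x 0 ≤ S * S := mul_le_mul (bρ x hx) (bθ x hx) s.le hS0.le
        have a2 : sol.ρ x 0 * (sol.u x 0 * sol.u x 0) ≤ S * S ^ 2 :=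
          mul_le_mul (bρ x hx) (bu x hx) (mul_self_nonneg _) hS0.le
        have a3 : sol.ρ x 0 * (sol.w 0 x 0 * sol.w 0 x 0 + sol.w 1 x 0 * sol.w 1 x 0)
            ≤ S * (S ^ 2 + S ^ 2) :=
          mul_le_mul (bρ x hx) (add_le_add (bw 0 x hx) (bw 1 x hx))
            (add_nonneg (mul_self_nonneg _) (mul_self_nonneg _)) hS0.le
        have a4 := bb 0 x hx
        have a5 := bb 1 x hx
        simp only [en, hEd]
        linarith)
    simpa using this
  have hR := rho_bound sol hκ hT.le hS0 hE0 hm hE bρ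
  have me : ∫ t in (0:ℝ)..T, (c1 * (supθ sol t ^ p - c2') - c3 * supθ sol t ^ (1 - α))
      ≤ (S + E) / (1 - α) := main_est sol hκ hC₀ hT.le hα hα1 hp hM hm i7 hE hR0 hR
  have cs := csup sol
  have cp : Continuous fun t => supθ sol t ^ p := cs.rpow_const fun _ => Or.inr hp.le
  show ∫ s in (0:ℝ)..T, supθ sol s ^ p ≤ _
  have low : ∫ t in (0:ℝ)..T, (c1 / 2 * supθ sol t ^ p - (c1 * c2' + c3 * c5))
      ≤ (S + E) / (1 - α) := by
    refine le_trans ?_ me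
    apply intervalIntegral.integral_mono_on hT.le
    · exact ((continuous_const.mul cp).sub continuous_const).intervalIntegrable _ _
    · exact ((continuous_const.mul (cp.sub continuous_const)).sub
        (continuous_const.mul (cs.rpow_const fun _ =>
          Or.inr (by linarith)))).intervalIntegrable _ _
    · intro t ht
      have hs := supθ_pos sol ht
      have h1 := hy _ hs
      have e : 1 - α + q = p := by rw [hpd]; ring
      rw [e] at h1
      have h2 := mul_le_mul_of_nonneg_left h1 c30
      have h3 : c3 * (c1 / (2 * (c3 + 1)) * supθ sol t ^ p) ≤ c1 / 2 * supθ sol t ^ p := by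
        have : c3 * (c1 / (2 * (c3 + 1))) ≤ c1 / 2 := by
          rw [mul_div_assoc', div_le_div_iff₀ (by positivity) (by positivity)]
          nlinarith
        have := mul_le_mul_of_nonneg_right this (Real.rpow_nonneg hs.le p)
        linarith
      linarith
  rw [intervalIntegral.integral_sub ((cp.intervalIntegrable _ _).const_mul _)
    (continuous_const.intervalIntegrable _ _), intervalIntegral.integral_const_mul] at low
  simp only [intervalIntegral.integral_const, sub_zero, smul_eq_mul] at low
  set I := ∫ s in (0:ℝ)..T, supθ sol s ^ p
  have h1 : c1 / 2 * I ≤ (S + E) / (1 - α) + T * (c1 * c2' + c3 * c5) := by linarith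
  have h2 := mul_le_mul_of_nonneg_left h1 (by positivity : 0 ≤ 2 / c1)
  have h3 : 2 / c1 * (c1 / 2 * I) = I := by field_simp
  linarith
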